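/- arXiv:2406.06057 — 3 statements merged into one kernel-verified Lean document; each statement's English description precedes it below -/
import Mathlib

section
/- Monotonicity properties of the Neumann logistic profiles: let K ∈ C¹(𝕋) be even with ∂_x K < 0 on (0, 0.5), μ > 0, and for y ∈ (0, 0.5) let θ_y be the solution of −μθ_y'' = θ_y(K − θ_y) on (y, 0.5) with θ_y'(y) = θ_y'(0.5) = 0, θ_y ≥ 0, θ_y(y) > 0. Then: (1) θ_y is decreasing on (y, 0.5) and satisfies K(0.5) ≤ θ_y ≤ K(y); (2) the map y ↦ θ_y(y) is decreasing and lim_{y → 0.5⁻} θ_y(y) = K(0.5). -/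
open MeasureTheory Real Set Filter
open scoped Topology

noncomputable section

/-- 1-periodicity: model of functions on the torus `𝕋 = (-0.5, 0.5)` with periodic
boundary conditions. -/
def Per1 (f : ℝ → ℝ) : Prop := ∀ x, f (x + 1) = f x

/-- The fundamental domain of the 1D torus. -/
def tI : Set ℝ := Ioc (-(1/2) : ℝ) (1/2)

/-- The support of a measure on `ℝ`. -/
def msupp (m : Measure ℝ) : Set ℝ := {x | ∀ U : Set ℝ, IsOpen U → x ∈ U → 0 < m U}

/-- Solution of the one-dimensional ergodic MFG system (MFG_ergo,1D):
`λ - (u')²/2 = θ` (in the viscosity sense), `(m u')' = 0` and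
`-μθ'' = θ(K - εm - θ)` (both in the sense of distributions), with
`θ ≥ 0`, `∫ u = 0`, and `m` a probability measure on the torus. -/
def IsErgo1DSol (μ ε lam : ℝ) (K θ u : ℝ → ℝ) (m : Measure ℝ) : Prop :=
  Per1 θ ∧ Continuous θ ∧ (∀ x, 0 ≤ θ x) ∧
  Per1 u ∧ Continuous u ∧ (∃ L, LipschitzWith L u) ∧ (∫ x in tI, u x) = 0 ∧
  IsProbabilityMeasure m ∧ m tI = 1 ∧
  -- Hamilton–Jacobi equation `λ - (u')²/2 = θ`, in the viscosity sense
  (∀ φ : ℝ → ℝ, ContDiff ℝ 2 φ → ∀ x : ℝ,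
    IsLocalMax (fun y => u y - φ y) x → lam - (deriv φ x)^2/2 ≤ θ x) ∧
  (∀ φ : ℝ → ℝ, ContDiff ℝ 2 φ → ∀ x : ℝ,
    IsLocalMin (fun y => u y - φ y) x → θ x ≤ lam - (deriv φ x)^2/2) ∧
  -- transport equation `(m u')' = 0`, in the sense of distributions
  (∀ φ : ℝ → ℝ, ContDiff ℝ 2 φ → Per1 φ → (∫ x, deriv φ x * deriv u x ∂m) = 0) ∧
  -- `-μ θ'' = θ(K - εm - θ)`, in the sense of distributions
  (∀ φ : ℝ → ℝ, ContDiff ℝ 2 φ → Per1 φ →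
    -(μ * ∫ x in tI, θ x * deriv (deriv φ) x) =
      (∫ x in tI, θ x * (K x - θ x) * φ x) - ε * ∫ x, θ x * φ x ∂m)

/-- Hypotheses on the resources distribution `K` for the one-dimensional results:
`K ∈ C¹(𝕋)`, even, strictly decreasing on `(0, 0.5)`. -/
def K1D (K : ℝ → ℝ) : Prop :=
  ContDiff ℝ 1 K ∧ Per1 K ∧ (∀ x, K (-x) = K x) ∧
  ∀ x ∈ Ioo (0:ℝ) (1/2), deriv K x < 0

lemma lem_right {a b : ℝ} {g g' : ℝ → ℝ}
    (hg : ∀ x ∈ Icc a b, HasDerivWithinAt g (g' x) (Icc a b) x)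
    {x0 : ℝ} (h0 : x0 ∈ Icc a b) (h1 : x0 < b) (hmax : ∀ x ∈ Icc a b, g x ≤ g x0)
    (hpos : ∀ᶠ x in 𝓝[>] x0, 0 < g' x) : False := by
  obtain ⟨u, hu, hu'⟩ := (mem_nhdsGT_iff_exists_Ioo_subset' h1).1 hpos
  have hu0 : x0 < u := hu
  have hv1 : x0 < min u b := lt_min hu0 h1
  have hsub : Icc x0 (min u b) ⊆ Icc a b := Icc_subset_Icc h0.1 (min_le_right _ _)
  have hm : StrictMonoOn g (Icc x0 (min u b)) := by
    apply strictMonoOn_of_deriv_pos (convex_Icc _ _)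
    · exact fun x hx => ((hg x (hsub hx)).continuousWithinAt).mono hsub
    · intro x hx
      rw [interior_Icc] at hx
      have hxI : x ∈ Ioo a b := ⟨h0.1.trans_lt hx.1, hx.2.trans_le (min_le_right _ _)⟩
      rw [((hg x (Ioo_subset_Icc_self hxI)).hasDerivAt (Icc_mem_nhds hxI.1 hxI.2)).deriv]
      exact hu' ⟨hx.1, hx.2.trans_le (min_le_left _ _)⟩
  have h2 := hm (left_mem_Icc.2 hv1.le) (right_mem_Icc.2 hv1.le) hv1
  have h3 := hmax _ (hsub (right_mem_Icc.2 hv1.le))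
  linarith

lemma lem_left {a b : ℝ} {g g' : ℝ → ℝ}
    (hg : ∀ x ∈ Icc a b, HasDerivWithinAt g (g' x) (Icc a b) x)
    {x0 : ℝ} (h0 : x0 ∈ Icc a b) (h1 : a < x0) (hmax : ∀ x ∈ Icc a b, g x ≤ g x0)
    (hneg : ∀ᶠ x in 𝓝[<] x0, g' x < 0) : False := by
  obtain ⟨u, hu, hu'⟩ := (mem_nhdsLT_iff_exists_Ioo_subset' h1).1 hneg
  have hu0 : u < x0 := hu
  have hv1 : max u a < x0 := max_lt hu0 h1
  have hsub : Icc (max u a) x0 ⊆ Icc a b := Icc_subset_Icc (le_max_right _ _) h0.2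
  have hm : StrictAntiOn g (Icc (max u a) x0) := by
    apply strictAntiOn_of_deriv_neg (convex_Icc _ _)
    · exact fun x hx => ((hg x (hsub hx)).continuousWithinAt).mono hsub
    · intro x hx
      rw [interior_Icc] at hx
      have hxI : x ∈ Ioo a b := ⟨(le_max_right _ _).trans_lt hx.1, hx.2.trans_le h0.2⟩
      rw [((hg x (Ioo_subset_Icc_self hxI)).hasDerivAt (Icc_mem_nhds hxI.1 hxI.2)).deriv]
      exact hu' ⟨(le_max_left _ _).trans_lt hx.1, hx.2⟩
  have h2 := hm (left_mem_Icc.2 hv1.le) (right_mem_Icc.2 hv1.le) hv1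
  have h3 := hmax _ (hsub (left_mem_Icc.2 hv1.le))
  linarith

lemma nhdsGT_le_aux {a b x0 : ℝ} (h0 : x0 ∈ Icc a b) (h1 : x0 < b) :
    𝓝[>] x0 ≤ 𝓝[Icc a b \ {x0}] x0 := by
  rw [← nhdsWithin_Ioo_eq_nhdsGT h1]
  exact nhdsWithin_mono _ fun x hx => ⟨⟨h0.1.trans hx.1.le, hx.2.le⟩, hx.1.ne'⟩

lemma nhdsLT_le_aux {a b x0 : ℝ} (h0 : x0 ∈ Icc a b) (h1 : a < x0) :
    𝓝[<] x0 ≤ 𝓝[Icc a b \ {x0}] x0 := by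
  rw [← nhdsWithin_Ioo_eq_nhdsLT h1]
  exact nhdsWithin_mono _ fun x hx => ⟨⟨hx.1.le, hx.2.le.trans h0.2⟩, hx.2.ne⟩

/-- second order condition at a critical maximum point, endpoints allowed -/
lemma second_order {a b : ℝ} (hab : a < b) {g g' : ℝ → ℝ} {c : ℝ}
    (hg : ∀ x ∈ Icc a b, HasDerivWithinAt g (g' x) (Icc a b) x)
    {x0 : ℝ} (h0 : x0 ∈ Icc a b) (hmax : ∀ x ∈ Icc a b, g x ≤ g x0)
    (hg0 : g' x0 = 0) (hc : HasDerivWithinAt g' c (Icc a b) x0) : c ≤ 0 := by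
  by_contra! hcpos
  have hs := (hasDerivWithinAt_iff_tendsto_slope.1 hc).eventually (lt_mem_nhds hcpos)
  rcases lt_or_eq_of_le h0.2 with h1 | h1
  · apply lem_right hg h0 h1 hmax
    filter_upwards [hs.filter_mono (nhdsGT_le_aux h0 h1), self_mem_nhdsWithin] with x hx hx'
    rw [slope_def_field, hg0, sub_zero] at hx
    have : (0:ℝ) < x - x0 := sub_pos.2 hx'
    exact (div_pos_iff_of_pos_right this).1 hx
  · have h2 : a < x0 := h1 ▸ hab
    apply lem_left hg h0 h2 hmax
    filter_upwards [hs.filter_mono (nhdsLT_le_aux h0 h2), self_mem_nhdsWithin] with x hx hx'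
    rw [slope_def_field, hg0, sub_zero] at hx
    have : x - x0 < 0 := sub_neg.2 hx'
    by_contra! h
    exact absurd hx (not_lt.2 (div_nonpos_of_nonneg_of_nonpos h this.le))

lemma max_principle {a b : ℝ} (hab : a < b) {g g' g'' : ℝ → ℝ}
    (hg : ∀ x ∈ Icc a b, HasDerivWithinAt g (g' x) (Icc a b) x)
    (hg' : ∀ x ∈ Icc a b, HasDerivWithinAt g' (g'' x) (Icc a b) x)
    (ha : 0 ≤ g' a) (hb : g' b ≤ 0) :
    ∃ x0 ∈ Icc a b, (∀ x ∈ Icc a b, g x ≤ g x0) ∧ g' x0 = 0 ∧ g'' x0 ≤ 0 := by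
  obtain ⟨x0, h0, hm⟩ := isCompact_Icc.exists_isMaxOn (nonempty_Icc.2 hab.le)
    (fun x hx => (hg x hx).continuousWithinAt : ContinuousOn g (Icc a b))
  have hmax : ∀ x ∈ Icc a b, g x ≤ g x0 := fun x hx => hm hx
  have hcont := (hg' x0 h0).continuousWithinAt.mono_left
    (nhdsWithin_mono x0 (sdiff_subset : Icc a b \ {x0} ⊆ Icc a b))
  have hle : g' x0 ≤ 0 := by
    rcases lt_or_eq_of_le h0.2 with h1 | h1
    · by_contra! h
      exact lem_right hg h0 h1 hmax
        ((hcont.mono_left (nhdsGT_le_aux h0 h1)).eventually (lt_mem_nhds h))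
    · rw [h1]; exact hb
  have hge : 0 ≤ g' x0 := by
    rcases lt_or_eq_of_le h0.1 with h1 | h1
    · by_contra! h
      exact lem_left hg h0 h1 hmax
        ((hcont.mono_left (nhdsLT_le_aux h0 h1)).eventually (gt_mem_nhds h))
    · rw [← h1]; exact ha
  have h00 := le_antisymm hle hge
  exact ⟨x0, h0, hmax, h00, second_order hab hg h0 hmax h00 (hg' x0 h0)⟩

/-- positivity of the profile -/
lemma profile_pos {μ : ℝ} {K : ℝ → ℝ} (hK : Continuous K) {a b : ℝ} {f f' : ℝ → ℝ}
    (hf : ∀ x ∈ Icc a b, HasDerivWithinAt f (f' x) (Icc a b) x)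
    (hf' : ∀ x ∈ Icc a b, HasDerivWithinAt f' (-(f x * (K x - f x)) / μ) (Icc a b) x)
    (hb : f' b = 0) (hnn : ∀ x ∈ Icc a b, 0 ≤ f x) (hpos : 0 < f a) :
    ∀ x ∈ Icc a b, 0 < f x := by
  intro x0 h0
  by_contra! hle
  have hz : f x0 = 0 := le_antisymm hle (hnn x0 h0)
  have hax : a < x0 := lt_of_le_of_ne h0.1 (by rintro rfl; linarith)
  have hz' : f' x0 = 0 := by
    rcases lt_or_eq_of_le h0.2 with h1 | h1
    · have hn : Icc a b ∈ 𝓝 x0 := Icc_mem_nhds hax h1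
      have hmin : IsLocalMin f x0 := by
        filter_upwards [hn] with x hx
        rw [hz]; exact hnn x hx
      exact hmin.hasDerivAt_eq_zero ((hf x0 h0).hasDerivAt hn)
    · rw [h1]; exact hb
  have hfc : ContinuousOn f (Icc a b) := fun x hx => (hf x hx).continuousWithinAt
  have hf'c : ContinuousOn f' (Icc a b) := fun x hx => (hf' x hx).continuousWithinAt
  have hcc : ContinuousOn (fun x => 1 - (K x - f x) / μ) (Icc a b) := by fun_prop
  obtain ⟨C, hC⟩ := isCompact_Icc.exists_bound_of_continuousOn hcc
  have hsub : Icc a x0 ⊆ Icc a b := Icc_subset_Icc le_rfl h0.2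
  have hmono : MonotoneOn (fun x => ((f x)^2 + (f' x)^2) * Real.exp (C * x)) (Icc a x0) := by
    apply monotoneOn_of_hasDerivWithinAt_nonneg (convex_Icc _ _)
      (f' := fun x => (2 * f x * f' x * (1 - (K x - f x) / μ) + C * ((f x)^2 + (f' x)^2))
        * Real.exp (C * x))
    · have : ContinuousOn (fun x => ((f x)^2 + (f' x)^2) * Real.exp (C * x)) (Icc a b) := by
        fun_prop
      exact this.mono hsub
    · intro x hx
      rw [interior_Icc] at hx ⊢
      have hx' := hsub (Ioo_subset_Icc_self hx)
      have hn : Icc a b ∈ 𝓝 x := Icc_mem_nhds hx.1 (hx.2.trans_le h0.2)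
      have e1 := (hf x hx').hasDerivAt hn
      have e2 := (hf' x hx').hasDerivAt hn
      have e3 : HasDerivAt (fun x => Real.exp (C * x)) (Real.exp (C * x) * (C * 1)) x :=
        ((hasDerivAt_id x).const_mul C).exp
      refine ((((e1.pow 2).add (e2.pow 2)).mul e3).hasDerivWithinAt).congr_deriv ?_
      simp only [Pi.add_apply, Pi.pow_apply]
      push_cast
      ring
    · intro x hx
      rw [interior_Icc] at hx
      have h1 := hC x (hsub (Ioo_subset_Icc_self hx))
      rw [Real.norm_eq_abs, abs_le] at h1
      apply mul_nonneg _ (Real.exp_pos _).le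
      nlinarith [mul_nonneg (sub_nonneg.2 h1.1) (sq_nonneg (f x + f' x)),
        mul_nonneg (sub_nonneg.2 h1.2) (sq_nonneg (f x - f' x))]
  have h1 := hmono (left_mem_Icc.2 hax.le) (right_mem_Icc.2 hax.le) hax.le
  simp only [hz, hz'] at h1
  have h2 : 0 < ((f a)^2 + (f' a)^2) * Real.exp (C * a) := by positivity
  norm_num at h1
  linarith

lemma profile_deriv_neg {μ : ℝ} (hμ : 0 < μ) {K : ℝ → ℝ} (hKd : Differentiable ℝ K)
    {a b : ℝ} (hab : a < b) (hKn : ∀ x ∈ Ioo a b, deriv K x < 0) {f f' : ℝ → ℝ}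
    (hf : ∀ x ∈ Icc a b, HasDerivWithinAt f (f' x) (Icc a b) x)
    (hf' : ∀ x ∈ Icc a b, HasDerivWithinAt f' (-(f x * (K x - f x)) / μ) (Icc a b) x)
    (ha : f' a = 0) (hb : f' b = 0) (hpos : ∀ x ∈ Icc a b, 0 < f x) :
    ∀ x ∈ Ioo a b, f' x < 0 := by
  intro x1 hx1
  by_contra! h1
  have hq : ∀ x ∈ Icc a b, HasDerivWithinAt (fun x => f' x / f x)
      ((f x - K x) / μ - (f' x / f x)^2) (Icc a b) x := by
    intro x hx
    have hp := hpos x hx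
    refine ((hf' x hx).div (hf x hx) hp.ne').congr_deriv ?_
    field_simp
    ring
  have hq' : ∀ x ∈ Icc a b, HasDerivWithinAt (fun x => (f x - K x) / μ - (f' x / f x)^2)
      ((f' x - deriv K x) / μ - 2 * (f' x / f x) * ((f x - K x) / μ - (f' x / f x)^2))
      (Icc a b) x := by
    intro x hx
    refine ((((hf x hx).sub (hKd x).hasDerivAt.hasDerivWithinAt).div_const μ).sub
      ((hq x hx).pow 2)).congr_deriv ?_
    push_cast
    ring
  obtain ⟨x2, h2, hm⟩ := isCompact_Icc.exists_isMaxOn (nonempty_Icc.2 hab.le)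
    (fun x hx => (hq x hx).continuousWithinAt : ContinuousOn (fun x => f' x / f x) (Icc a b))
  have hx1' := Ioo_subset_Icc_self hx1
  have hq1 : 0 ≤ f' x1 / f x1 := div_nonneg h1 (hpos x1 hx1').le
  obtain ⟨x0, h0, hmax⟩ : ∃ x0 ∈ Ioo a b, ∀ x ∈ Icc a b, f' x / f x ≤ f' x0 / f x0 := by
    have hm' : ∀ x ∈ Icc a b, f' x / f x ≤ f' x2 / f x2 := fun x hx => hm hx
    rcases eq_or_ne x2 a with rfl | ha2
    · refine ⟨x1, hx1, fun x hx => (hm' x hx).trans ?_⟩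
      rw [ha, zero_div]; exact hq1
    rcases eq_or_ne x2 b with rfl | hb2
    · refine ⟨x1, hx1, fun x hx => (hm' x hx).trans ?_⟩
      rw [hb, zero_div]; exact hq1
    exact ⟨x2, ⟨lt_of_le_of_ne h2.1 ha2.symm, lt_of_le_of_ne h2.2 hb2⟩, hm'⟩
  have h0' := Ioo_subset_Icc_self h0
  have hn : Icc a b ∈ 𝓝 x0 := Icc_mem_nhds h0.1 h0.2
  have hlm : IsLocalMax (fun x => f' x / f x) x0 := by
    filter_upwards [hn] with x hx using hmax x hx
  have hz := hlm.hasDerivAt_eq_zero ((hq x0 h0').hasDerivAt hn)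
  have h3 := second_order hab hq h0' hmax hz (hq' x0 h0')
  rw [hz, mul_zero, sub_zero] at h3
  have h4 : 0 ≤ f' x0 := by
    have := hq1.trans (hmax x1 hx1')
    by_contra! h
    exact absurd (div_neg_of_neg_of_pos h (hpos x0 h0')) (not_lt.2 this)
  have h5 : 0 < (f' x0 - deriv K x0) / μ := div_pos (by linarith [hKn x0 h0]) hμ
  linarith

lemma profile_compare {μ : ℝ} (hμ : 0 < μ) {K : ℝ → ℝ}
    {a b : ℝ} (hab : a < b) {f f' h h' : ℝ → ℝ}
    (hf : ∀ x ∈ Icc a b, HasDerivWithinAt f (f' x) (Icc a b) x)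
    (hf' : ∀ x ∈ Icc a b, HasDerivWithinAt f' (-(f x * (K x - f x)) / μ) (Icc a b) x)
    (hh : ∀ x ∈ Icc a b, HasDerivWithinAt h (h' x) (Icc a b) x)
    (hh' : ∀ x ∈ Icc a b, HasDerivWithinAt h' (-(h x * (K x - h x)) / μ) (Icc a b) x)
    (hpf : ∀ x ∈ Icc a b, 0 < f x) (hph : ∀ x ∈ Icc a b, 0 < h x)
    (hfa : f' a ≤ 0) (hfb : f' b = 0) (hha : h' a = 0) (hhb : h' b = 0) : h a ≤ f a := by
  have d1 : ∀ x ∈ Icc a b, HasDerivWithinAt (fun x => h x / f x)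
      ((h' x * f x - h x * f' x) / (f x)^2) (Icc a b) x :=
    fun x hx => (hh x hx).div (hf x hx) (hpf x hx).ne'
  have d2 : ∀ x ∈ Icc a b, HasDerivWithinAt (fun x => (h' x * f x - h x * f' x) / (f x)^2)
      (h x * (h x - f x) / (μ * f x) - 2 * f' x / f x * ((h' x * f x - h x * f' x) / (f x)^2))
      (Icc a b) x := by
    intro x hx
    have hp := hpf x hx
    refine ((((hh' x hx).mul (hf x hx)).sub ((hh x hx).mul (hf' x hx))).div
      ((hf x hx).pow 2) (pow_ne_zero 2 hp.ne')).congr_deriv ?_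
    simp only [Pi.mul_apply, Pi.sub_apply, Pi.pow_apply]
    push_cast
    field_simp
    ring
  have hA : a ∈ Icc a b := left_mem_Icc.2 hab.le
  obtain ⟨x0, h0, hmax, hz, hsec⟩ := max_principle hab d1 d2
    (by
      have := hph a hA
      rw [hha]
      apply div_nonneg _ (sq_nonneg _)
      nlinarith) (by rw [hhb, hfb]; simp)
  rw [hz, mul_zero, sub_zero] at hsec
  have p1 := hpf x0 h0
  have p2 := hph x0 h0
  have hle : h x0 ≤ f x0 := by
    by_contra! hlt
    have : 0 < h x0 * (h x0 - f x0) / (μ * f x0) :=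
      div_pos (mul_pos p2 (sub_pos.2 hlt)) (mul_pos hμ p1)
    linarith
  have h1 : h a / f a ≤ 1 := (hmax a hA).trans ((div_le_one p1).2 hle)
  exact (div_le_one (hpf a hA)).1 h1

/-- Lemma 6.1: monotonicity properties of the Neumann logistic
profiles. For `y ∈ (0, 0.5)`, let `θ_y` solve `-μθ_y'' = θ_y(K - θ_y)` on `(y, 0.5)`
with Neumann conditions `θ_y'(y) = θ_y'(0.5) = 0`, `θ_y ≥ 0`, `θ_y(y) > 0`. Then:
(1) `θ_y` is decreasing on `(y, 0.5)` and `K(0.5) ≤ θ_y ≤ K(y)`;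
(2) `y ↦ θ_y(y)` is decreasing and `θ_y(y) → K(0.5)` as `y → 0.5⁻`. -/
theorem neumann_profiles (μ : ℝ) (hμ : 0 < μ) (K : ℝ → ℝ) (hK : K1D K)
    (Θ Θ' : ℝ → ℝ → ℝ)
    (hsol : ∀ y ∈ Ioo (0:ℝ) (1/2),
      (∀ x ∈ Icc y (1/2), HasDerivWithinAt (Θ y) (Θ' y x) (Icc y (1/2)) x) ∧
      (∀ x ∈ Icc y (1/2),
        HasDerivWithinAt (Θ' y) (-(Θ y x * (K x - Θ y x)) / μ) (Icc y (1/2)) x) ∧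
      Θ' y y = 0 ∧ Θ' y (1/2) = 0 ∧
      (∀ x ∈ Icc y (1/2), 0 ≤ Θ y x) ∧ 0 < Θ y y) :
    (∀ y ∈ Ioo (0:ℝ) (1/2),
      StrictAntiOn (Θ y) (Icc y (1/2)) ∧
      ∀ x ∈ Icc y (1/2), K (1/2) ≤ Θ y x ∧ Θ y x ≤ K y) ∧
    StrictAntiOn (fun y => Θ y y) (Ioo (0:ℝ) (1/2)) ∧
    Tendsto (fun y => Θ y y) (𝓝[<] (1/2 : ℝ)) (𝓝 (K (1/2))) := by
  obtain ⟨hK1, -, -, hKn⟩ := hK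
  have hKd : Differentiable ℝ K := hK1.differentiable (by norm_num)
  have hKc : Continuous K := hK1.continuous
  have hKanti : StrictAntiOn K (Icc 0 (1/2)) :=
    strictAntiOn_of_deriv_neg (convex_Icc _ _) hKc.continuousOn
      (by rw [interior_Icc]; exact hKn)
  have hpos : ∀ y ∈ Ioo (0:ℝ) (1/2), ∀ x ∈ Icc y (1/2), 0 < Θ y x := by
    intro y hy
    obtain ⟨h1, h2, h3, h4, h5, h6⟩ := hsol y hy
    exact profile_pos hKc h1 h2 h4 h5 h6
  have hneg : ∀ y ∈ Ioo (0:ℝ) (1/2), ∀ x ∈ Ioo y (1/2), Θ' y x < 0 := by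
    intro y hy
    obtain ⟨h1, h2, h3, h4, h5, h6⟩ := hsol y hy
    exact profile_deriv_neg hμ hKd hy.2 (fun x hx => hKn x ⟨hy.1.trans hx.1, hx.2⟩)
      h1 h2 h3 h4 (hpos y hy)
  have hanti : ∀ y ∈ Ioo (0:ℝ) (1/2), StrictAntiOn (Θ y) (Icc y (1/2)) := by
    intro y hy
    obtain ⟨h1, h2, h3, h4, h5, h6⟩ := hsol y hy
    apply strictAntiOn_of_deriv_neg (convex_Icc _ _)
    · exact fun x hx => (h1 x hx).continuousWithinAt
    · intro x hx
      rw [interior_Icc] at hx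
      rw [((h1 x (Ioo_subset_Icc_self hx)).hasDerivAt (Icc_mem_nhds hx.1 hx.2)).deriv]
      exact hneg y hy x hx
  have hbd : ∀ y ∈ Ioo (0:ℝ) (1/2), ∀ x ∈ Icc y (1/2), K (1/2) ≤ Θ y x ∧ Θ y x ≤ K y := by
    intro y hy x hx
    obtain ⟨h1, h2, h3, h4, h5, h6⟩ := hsol y hy
    constructor
    · obtain ⟨x0, h0, hmax, -, hs⟩ := max_principle hy.2 (g := fun x => -Θ y x)
        (fun x hx => (h1 x hx).neg) (fun x hx => (h2 x hx).neg) (by simp [h3]) (by rw [h4]; simp)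
      have p := hpos y hy x0 h0
      have hle : K x0 ≤ Θ y x0 := by
        by_contra! hlt
        have : 0 < Θ y x0 * (K x0 - Θ y x0) / μ := div_pos (mul_pos p (sub_pos.2 hlt)) hμ
        rw [neg_div, neg_neg] at hs
        linarith
      have hk : K (1/2) ≤ K x0 := hKanti.antitoneOn ⟨hy.1.le.trans h0.1, h0.2⟩
        ⟨by norm_num, le_rfl⟩ h0.2
      have := hmax x hx
      linarith
    · obtain ⟨x0, h0, hmax, -, hs⟩ := max_principle hy.2 h1 h2 h3.ge h4.le
      have p := hpos y hy x0 h0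
      have hle : Θ y x0 ≤ K x0 := by
        by_contra! hlt
        have : 0 < Θ y x0 * (Θ y x0 - K x0) / μ := div_pos (mul_pos p (sub_pos.2 hlt)) hμ
        have e : -(Θ y x0 * (K x0 - Θ y x0)) / μ = Θ y x0 * (Θ y x0 - K x0) / μ := by ring
        linarith
      have hk : K x0 ≤ K y := hKanti.antitoneOn ⟨hy.1.le, hy.2.le⟩
        ⟨hy.1.le.trans h0.1, h0.2⟩ h0.1
      exact (hmax x hx).trans (hle.trans hk)
  refine ⟨fun y hy => ⟨hanti y hy, hbd y hy⟩, ?_, ?_⟩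
  · intro y hy z hz hyz
    obtain ⟨h1, h2, h3, h4, h5, h6⟩ := hsol y hy
    obtain ⟨k1, k2, k3, k4, k5, k6⟩ := hsol z hz
    have hsub : Icc z (1/2) ⊆ Icc y (1/2) := Icc_subset_Icc hyz.le le_rfl
    have c1 : Θ z z ≤ Θ y z := profile_compare hμ hz.2
      (fun x hx => (h1 x (hsub hx)).mono hsub) (fun x hx => (h2 x (hsub hx)).mono hsub)
      k1 k2 (fun x hx => hpos y hy x (hsub hx)) (hpos z hz)
      (hneg y hy z ⟨hyz, hz.2⟩).le h4 k3 k4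
    have c2 : Θ y z < Θ y y := hanti y hy (left_mem_Icc.2 hy.2.le) ⟨hyz.le, hz.2.le⟩ hyz
    exact c1.trans_lt c2
  · have hev : ∀ᶠ y in 𝓝[<] (1/2 : ℝ), y ∈ Ioo (0:ℝ) (1/2) := Ioo_mem_nhdsLT (by norm_num)
    refine tendsto_of_tendsto_of_tendsto_of_le_of_le' tendsto_const_nhds
      (hKc.continuousAt.tendsto.mono_left nhdsWithin_le_nhds) ?_ ?_
    · filter_upwards [hev] with y hy using (hbd y hy y (left_mem_Icc.2 hy.2.le)).1
    · filter_upwards [hev] with y hy using (hbd y hy y (left_mem_Icc.2 hy.2.le)).2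

end
end

section
/- Absence of atoms of the equilibrium distribution of fishermen: let 𝕋 be identified with (−0.5, 0.5) with periodic boundary conditions and K ∈ C¹(𝕋) be even with ∂_x K < 0 on (0, 0.5). If (λ̄, θ̄, m̄, ū) is a solution of the one-dimensional ergodic system (MFG_ergo,1D) with θ̄ ≢ 0, then the measure m̄ has no atoms; consequently θ̄ is C¹ on 𝕋. -/
open MeasureTheory Real Set Filter
open scoped Topology

noncomputable section

/-- Green kernel on `[a, a+1]`. -/
def gk (a x s : ℝ) : ℝ := max (x - s) 0 - (x - a) * (a + 1 - s)

/-- Potential of `w ρ`. -/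
def pot (a : ℝ) (ρ : Measure ℝ) (w : ℝ → ℝ) (s : ℝ) : ℝ := ∫ x, gk a x s * w x ∂ρ

/-- Derivative of the potential. -/
def dpot (a : ℝ) (ρ : Measure ℝ) (w : ℝ → ℝ) (s : ℝ) : ℝ :=
  ∫ x, ((Ioi s).indicator (fun _ => (-1 : ℝ)) x + (x - a)) * w x ∂ρ

lemma gk_continuous (a : ℝ) : Continuous (fun p : ℝ × ℝ => gk a p.1 p.2) := by
  unfold gk; fun_prop

lemma gk_bound {a x s : ℝ} (hx : x ∈ Icc a (a+1)) : |gk a x s| ≤ 2 * (1 + |s - a|) := by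
  unfold gk
  have h1 : |max (x - s) 0| ≤ 1 + |s - a| := by
    rw [abs_of_nonneg (le_max_right _ _)]
    apply max_le
    · have := neg_abs_le (s - a); linarith [hx.2]
    · positivity
  have h2 : |(x - a) * (a + 1 - s)| ≤ 1 + |s - a| := by
    rw [abs_mul]
    have h3 : |x - a| ≤ 1 := by rw [abs_le]; constructor <;> linarith [hx.1, hx.2]
    have h4 : |a + 1 - s| ≤ 1 + |s - a| := by
      rw [abs_le]; constructor <;> linarith [neg_abs_le (s - a), le_abs_self (s-a)]
    nlinarith [abs_nonneg (x - a), abs_nonneg (a+1-s)]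
  have := abs_sub (max (x - s) 0) ((x - a) * (a + 1 - s))
  linarith

lemma gk_lip {a x s t : ℝ} (hx : x ∈ Icc a (a+1)) : |gk a x s - gk a x t| ≤ 2 * |s - t| := by
  unfold gk
  have h1 : |max (x - s) 0 - max (x - t) 0| ≤ |s - t| := by
    have := abs_max_sub_max_le_abs (x - s) (x - t) 0
    rwa [show x - s - (x - t) = -(s - t) by ring, abs_neg] at this
  have h2 : |(x - a) * (s - t)| ≤ |s - t| := by
    rw [abs_mul]
    have h3 : |x - a| ≤ 1 := by rw [abs_le]; constructor <;> linarith [hx.1, hx.2]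
    nlinarith [abs_nonneg (x - a), abs_nonneg (s-t)]
  have := abs_add_le (max (x - s) 0 - max (x - t) 0) ((x - a) * (s - t))
  rw [show max (x - s) 0 - (x - a) * (a + 1 - s) - (max (x - t) 0 - (x - a) * (a + 1 - t))
    = max (x - s) 0 - max (x - t) 0 + (x - a) * (s - t) by ring]
  linarith

section pots
set_option linter.unusedSectionVars false
variable {a C : ℝ} {ρ : Measure ℝ} [IsFiniteMeasure ρ] {w : ℝ → ℝ}

lemma gkw_int (hρ : ∀ᵐ x ∂ρ, x ∈ Icc a (a+1)) (hw : Continuous w) (hC : ∀ x, |w x| ≤ C) (s : ℝ) :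
    Integrable (fun x => gk a x s * w x) ρ := by
  have hm : Continuous (fun x => gk a x s * w x) :=
    ((gk_continuous a).comp (Continuous.prodMk_left s)).mul hw
  refine Integrable.of_bound hm.aestronglyMeasurable (2 * (1 + |s - a|) * C) ?_
  filter_upwards [hρ] with x hx
  rw [Real.norm_eq_abs, abs_mul]
  exact mul_le_mul (gk_bound hx) (hC x) (abs_nonneg _) (by positivity)

lemma pot_continuous (hρ : ∀ᵐ x ∂ρ, x ∈ Icc a (a+1)) (hw : Continuous w) (hC : ∀ x, |w x| ≤ C) :
    Continuous (pot a ρ w) := by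
  rw [continuous_iff_continuousAt]
  intro s0
  unfold pot
  have hC0 : 0 ≤ C := (abs_nonneg _).trans (hC 0)
  refine continuousAt_of_dominated (bound := fun _ => 2 * (1 + (|s0 - a| + 1)) * C)
    (Eventually.of_forall fun s => (gkw_int hρ hw hC s).aestronglyMeasurable) ?_
    (integrable_const _) ?_
  · filter_upwards [Metric.ball_mem_nhds s0 one_pos] with s hs
    filter_upwards [hρ] with x hx
    rw [Real.norm_eq_abs, abs_mul]
    have h1 : |s - a| ≤ |s0 - a| + 1 := by
      have := abs_add_le (s - s0) (s0 - a)
      rw [Metric.mem_ball, Real.dist_eq] at hs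
      rw [show s - s0 + (s0 - a) = s - a by ring] at this
      linarith
    refine mul_le_mul ((gk_bound hx).trans ?_) (hC x) (abs_nonneg _) (by positivity)
    linarith
  · refine Eventually.of_forall fun x => ?_
    exact (((gk_continuous a).comp (Continuous.prodMk_right x)).mul continuous_const).continuousAt

lemma gk_hasDerivAt {x s : ℝ} (h : x ≠ s) :
    HasDerivAt (gk a x) ((Ioi s).indicator (fun _ => (-1 : ℝ)) x + (x - a)) s := by
  have h2 : HasDerivAt (fun t : ℝ => (x - a) * (a + 1 - t)) (-(x - a)) s := by
    have := ((hasDerivAt_id s).const_sub (a + 1)).const_mul (x - a)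
    simpa using this
  have h1 : HasDerivAt (fun t : ℝ => max (x - t) 0) ((Ioi s).indicator (fun _ => (-1 : ℝ)) x) s := by
    rcases lt_or_gt_of_ne h with h | h
    · rw [indicator_of_notMem (by simpa using h.le)]
      refine (hasDerivAt_const s (0:ℝ)).congr_of_eventuallyEq ?_
      filter_upwards [lt_mem_nhds h] with t ht
      exact max_eq_right (by linarith)
    · rw [indicator_of_mem (by simpa using h)]
      refine ((hasDerivAt_id s).const_sub x).congr_of_eventuallyEq ?_
      filter_upwards [gt_mem_nhds h] with t ht
      exact max_eq_left (by linarith)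
  have := h1.sub h2
  rw [sub_neg_eq_add] at this
  exact this

lemma dk_bound {x s : ℝ} (hx : x ∈ Icc a (a+1)) :
    |(Ioi s).indicator (fun _ => (-1 : ℝ)) x + (x - a)| ≤ 1 := by
  rw [abs_le]
  by_cases h : x ∈ Ioi s
  · rw [indicator_of_mem h]; constructor <;> linarith [hx.1, hx.2]
  · rw [indicator_of_notMem h]; constructor <;> linarith [hx.1, hx.2]

lemma dk_meas (hw : Continuous w) (s : ℝ) : Measurable
    (fun x => ((Ioi s).indicator (fun _ => (-1 : ℝ)) x + (x - a)) * w x) := by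
  refine Measurable.mul (Measurable.add ?_ (by fun_prop)) hw.measurable
  exact measurable_const.indicator measurableSet_Ioi

lemma ae_ne {s : ℝ} (h0 : ρ {s} = 0) : ∀ᵐ x ∂ρ, x ≠ s := by
  rw [ae_iff]; simpa using h0

lemma pot_hasDerivAt (hρ : ∀ᵐ x ∂ρ, x ∈ Icc a (a+1)) (hw : Continuous w) (hC : ∀ x, |w x| ≤ C)
    {s : ℝ} (h0 : ρ {s} = 0) : HasDerivAt (pot a ρ w) (dpot a ρ w s) s := by
  have hC0 : 0 ≤ C := (abs_nonneg _).trans (hC 0)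
  refine (hasDerivAt_integral_of_dominated_loc_of_lip (bound := fun _ => 2 * C) (s := univ)
    (F := fun s x => gk a x s * w x) univ_mem
    (Eventually.of_forall fun s => (gkw_int hρ hw hC s).aestronglyMeasurable)
    (gkw_int hρ hw hC s) (dk_meas hw s).aestronglyMeasurable ?_ (integrable_const _) ?_).2
  · filter_upwards [hρ] with x hx
    refine LipschitzOnWith.of_dist_le_mul fun s _ t _ => ?_
    rw [Real.dist_eq, Real.dist_eq, ← sub_mul, abs_mul, Real.coe_nnabs, abs_of_nonneg (by positivity : 0 ≤ 2 * C)]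
    calc _ ≤ 2 * |s - t| * C := mul_le_mul (gk_lip hx) (hC x) (abs_nonneg _) (by positivity)
      _ = _ := by ring
  · filter_upwards [ae_ne h0] with x hx
    exact (gk_hasDerivAt hx).mul_const _

lemma dpot_continuousAt (hρ : ∀ᵐ x ∂ρ, x ∈ Icc a (a+1)) (hw : Continuous w) (hC : ∀ x, |w x| ≤ C)
    {s : ℝ} (h0 : ρ {s} = 0) : ContinuousAt (dpot a ρ w) s := by
  have hC0 : 0 ≤ C := (abs_nonneg _).trans (hC 0)
  refine continuousAt_of_dominated (bound := fun _ => 1 * C)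
    (Eventually.of_forall fun s => (dk_meas hw s).aestronglyMeasurable) ?_
    (integrable_const _) ?_
  · refine Eventually.of_forall fun s => ?_
    filter_upwards [hρ] with x hx
    rw [Real.norm_eq_abs, abs_mul]
    exact mul_le_mul (dk_bound hx) (hC x) (abs_nonneg _) (by positivity)
  · filter_upwards [ae_ne h0] with x hx
    refine ContinuousAt.mul (ContinuousAt.add ?_ continuousAt_const) continuousAt_const
    rcases lt_or_gt_of_ne hx with h | h
    · refine (continuousAt_const (y := (0:ℝ))).congr ?_
      filter_upwards [lt_mem_nhds h] with t ht
      rw [indicator_of_notMem (by simpa using ht.le)]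
    · refine (continuousAt_const (y := (-1:ℝ))).congr ?_
      filter_upwards [gt_mem_nhds h] with t ht
      rw [indicator_of_mem (by simpa using ht)]

lemma pot_left (a : ℝ) (ρ : Measure ℝ) (w : ℝ → ℝ) (hρ : ∀ᵐ x ∂ρ, x ∈ Icc a (a+1)) : pot a ρ w a = 0 := by
  unfold pot
  refine integral_eq_zero_of_ae ?_
  filter_upwards [hρ] with x hx
  simp [gk, hx.1]

lemma pot_right (a : ℝ) (ρ : Measure ℝ) (w : ℝ → ℝ) (hρ : ∀ᵐ x ∂ρ, x ∈ Icc a (a+1)) : pot a ρ w (a+1) = 0 := by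
  unfold pot
  refine integral_eq_zero_of_ae ?_
  filter_upwards [hρ] with x hx
  simp [gk, max_eq_right (show x - (a+1) ≤ 0 by linarith [hx.2])]

lemma pot_fubini (hρ : ∀ᵐ x ∂ρ, x ∈ Icc a (a+1)) (hw : Continuous w) (hC : ∀ x, |w x| ≤ C)
    {χ : ℝ → ℝ} (hχ : Continuous χ) {D : ℝ} (hD : ∀ x, |χ x| ≤ D) :
    ∫ s in a..(a+1), pot a ρ w s * χ s = ∫ x, w x * (∫ s in a..(a+1), gk a x s * χ s) ∂ρ := by
  have hC0 : 0 ≤ C := (abs_nonneg _).trans (hC 0)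
  have hD0 : 0 ≤ D := (abs_nonneg _).trans (hD 0)
  have hint : Integrable (Function.uncurry fun s x => gk a x s * w x * χ s)
      ((volume.restrict (Set.uIoc a (a+1))).prod ρ) := by
    have : IsFiniteMeasure (volume.restrict (Set.uIoc a (a+1))) := by
      rw [uIoc_of_le (by linarith)]; infer_instance
    have hc : Continuous (Function.uncurry fun s x => gk a x s * w x * χ s) := by
      unfold gk Function.uncurry; fun_prop
    refine Integrable.of_bound hc.aestronglyMeasurable (2 * (1 + 1) * C * D) ?_
    have h1 : ∀ᵐ p ∂((volume.restrict (Set.uIoc a (a+1))).prod ρ), p.1 ∈ Set.uIoc a (a+1) :=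
      Measure.quasiMeasurePreserving_fst.ae (ae_restrict_mem measurableSet_uIoc)
    have h2 : ∀ᵐ p ∂((volume.restrict (Set.uIoc a (a+1))).prod ρ), p.2 ∈ Icc a (a+1) :=
      Measure.quasiMeasurePreserving_snd.ae hρ
    filter_upwards [h1, h2] with p h1 h2
    rw [uIoc_of_le (by linarith)] at h1
    have h3 : |p.1 - a| ≤ 1 := by rw [abs_le]; constructor <;> linarith [h1.1, h1.2]
    simp only [Function.uncurry, Real.norm_eq_abs, abs_mul]
    refine mul_le_mul (mul_le_mul ((gk_bound h2).trans ?_) (hC _) (abs_nonneg _) (by positivity)) (hD _) (abs_nonneg _) (by positivity)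
    linarith
  have := intervalIntegral_integral_swap hint
  unfold pot
  simp_rw [← integral_mul_const]
  rw [this]
  congr 1; ext x
  rw [← intervalIntegral.integral_const_mul]
  congr 1; ext s; ring

/-- Second difference of the potential. -/
lemma pot_second (hρ : ∀ᵐ x ∂ρ, x ∈ Icc a (a+1)) (hw : Continuous w) (hC : ∀ x, |w x| ≤ C)
    (hw0 : ∀ x, 0 ≤ w x) (s : ℝ) {h : ℝ} (hh : 0 < h) :
    h * (w s * ρ.real {s}) ≤ pot a ρ w (s+h) + pot a ρ w (s-h) - 2 * pot a ρ w s := by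
  have e : pot a ρ w (s+h) + pot a ρ w (s-h) - 2 * pot a ρ w s
      = ∫ x, (gk a x (s+h) * w x + gk a x (s-h) * w x - 2 * (gk a x s * w x)) ∂ρ := by
    unfold pot
    have i1 := gkw_int hρ hw hC (s+h)
    have i2 := gkw_int hρ hw hC (s-h)
    have i3 := (gkw_int hρ hw hC s).const_mul 2
    have i4 : Integrable (fun x => gk a x (s+h) * w x + gk a x (s-h) * w x) ρ := i1.add i2
    rw [integral_sub i4 i3, integral_add i1 i2, integral_const_mul]
  have e2 : h * (w s * ρ.real {s}) = ∫ x, ({s} : Set ℝ).indicator (fun _ => h * w s) x ∂ρ := by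
    rw [integral_indicator_const _ (measurableSet_singleton s), smul_eq_mul]; ring
  rw [e, e2]
  refine integral_mono ((integrable_const _).indicator (measurableSet_singleton s))
    (((gkw_int hρ hw hC _).add (gkw_int hρ hw hC _)).sub ((gkw_int hρ hw hC _).const_mul 2)) ?_
  intro x
  have e3 : gk a x (s+h) * w x + gk a x (s-h) * w x - 2 * (gk a x s * w x)
      = (max (x - (s+h)) 0 + max (x - (s-h)) 0 - 2 * max (x - s) 0) * w x := by
    unfold gk; ring
  simp only [e3]
  by_cases hx : x = s
  · subst hx
    simp [hh.le]
  · rw [indicator_of_notMem (by simpa using hx)]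
    refine mul_nonneg ?_ (hw0 x)
    rcases le_total (x - s) 0 with h1 | h1
    · rw [max_eq_right h1]; linarith [le_max_right (x - (s+h)) 0, le_max_right (x - (s-h)) 0]
    · rw [max_eq_left h1]; linarith [le_max_left (x - (s+h)) 0, le_max_left (x - (s-h)) 0, le_max_right (x - (s+h)) 0]

end pots

section testfn
variable {a : ℝ} {χ : ℝ → ℝ}

lemma per_cont_bdd {f : ℝ → ℝ} (hf : Continuous f) (hp : Per1 f) : ∃ C, ∀ x, |f x| ≤ C := by
  obtain ⟨C, hC⟩ := isCompact_Icc.exists_bound_of_continuousOn (s := Icc (0:ℝ) 1) hf.continuousOn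
  refine ⟨C, fun x => ?_⟩
  have hp' : Function.Periodic f 1 := hp
  obtain ⟨y, hy, e⟩ := hp'.exists_mem_Ico₀ one_pos x
  rw [e]
  exact hC y ⟨hy.1, hy.2.le⟩

lemma prim_hasDeriv (hχ : Continuous χ) (x : ℝ) : HasDerivAt (fun t => ∫ s in a..t, χ s) (χ x) x :=
  hχ.integral_hasStrictDerivAt a x |>.hasDerivAt

lemma prim_continuous (hχ : Continuous χ) : Continuous (fun t => ∫ s in a..t, χ s) :=
  continuous_iff_continuousAt.2 fun x => (prim_hasDeriv hχ x).continuousAt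

lemma prim_per (hχ : Continuous χ) (hp : Per1 χ) (h0 : ∫ s in a..(a+1), χ s = 0) :
    Per1 (fun t => ∫ s in a..t, χ s) := by
  intro t
  have hp' : Function.Periodic χ 1 := hp
  have := hp'.intervalIntegral_add_eq t a
  have h2 := intervalIntegral.integral_add_adjacent_intervals
    (hχ.intervalIntegrable (μ := volume) a t) (hχ.intervalIntegrable (μ := volume) t (t+1))
  simp only
  linarith

lemma double_prim (hχ : Continuous χ) (x : ℝ) :
    ∫ t in a..x, (∫ s in a..t, χ s) = ∫ s in a..x, (x - s) * χ s := by
  have := intervalIntegral.integral_mul_deriv_eq_deriv_mul (a := a) (b := x)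
    (u := fun s => x - s) (u' := fun _ => -1) (v := fun t => ∫ s in a..t, χ s) (v' := χ)
    (fun y _ => by simpa using (hasDerivAt_id y).const_sub x)
    (fun y _ => prim_hasDeriv hχ y) (by simp) (hχ.intervalIntegrable _ _)
  rw [this]
  simp

/-- The test function with second derivative `χ`. -/
lemma exists_test (hχ : Continuous χ) (hp : Per1 χ) (h0 : ∫ s in a..(a+1), χ s = 0) :
    ∃ φ : ℝ → ℝ, ContDiff ℝ 2 φ ∧ Per1 φ ∧ deriv (deriv φ) = χ ∧
      ∀ x ∈ Icc a (a+1), φ x = ∫ s in a..(a+1), gk a x s * χ s := by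
  set Ψ : ℝ → ℝ := fun t => ∫ s in a..t, χ s with hΨ
  have cΨ : Continuous Ψ := prim_continuous hχ
  have pΨ : Per1 Ψ := prim_per hχ hp h0
  set q := ∫ t in a..(a+1), Ψ t with hq
  set ψ : ℝ → ℝ := fun t => Ψ t - q with hψ
  have cψ : Continuous ψ := cΨ.sub continuous_const
  have pψ : Per1 ψ := fun x => by simp only [hψ, pΨ x]
  have iψ : ∫ t in a..(a+1), ψ t = 0 := by
    simp only [hψ]
    rw [intervalIntegral.integral_sub (cΨ.intervalIntegrable _ _) (by simp)]
    simp [hq]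
  have d1 : deriv (fun x => ∫ t in a..x, ψ t) = ψ := funext fun x => (prim_hasDeriv cψ x).deriv
  have d2' : ∀ x, HasDerivAt ψ (χ x) x := fun x => (prim_hasDeriv hχ x).sub_const q
  have d2 : deriv ψ = χ := funext fun x => (d2' x).deriv
  refine ⟨fun x => ∫ t in a..x, ψ t, ?_, prim_per cψ pψ iψ, by rw [d1, d2], ?_⟩
  · have c1 : ContDiff ℝ 1 ψ := by
      rw [contDiff_one_iff_deriv, d2]
      exact ⟨fun x => (d2' x).differentiableAt, hχ⟩
    rw [show (2 : WithTop ℕ∞) = 1 + 1 by norm_num, contDiff_succ_iff_deriv, d1]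
    exact ⟨fun x => (prim_hasDeriv cψ x).differentiableAt, by simp, c1⟩
  · intro x hx
    have e1 : ∫ t in a..x, ψ t = (∫ s in a..x, (x - s) * χ s) - (x - a) * q := by
      simp only [hψ]
      rw [intervalIntegral.integral_sub (cΨ.intervalIntegrable _ _) (by simp)]
      rw [hΨ, double_prim hχ]
      simp
    have e2 : q = ∫ s in a..(a+1), (a + 1 - s) * χ s := double_prim hχ (a+1)
    have cm : Continuous (fun s => max (x - s) 0 * χ s) := by fun_prop
    have e3 : ∫ s in a..(a+1), max (x - s) 0 * χ s = ∫ s in a..x, (x - s) * χ s := by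
      rw [← intervalIntegral.integral_add_adjacent_intervals
        (cm.intervalIntegrable a x) (cm.intervalIntegrable x (a+1))]
      have z : ∫ s in x..(a+1), max (x - s) 0 * χ s = 0 := by
        rw [intervalIntegral.integral_congr (g := fun _ => (0:ℝ))]
        · simp
        · intro s hs
          rw [uIcc_of_le hx.2] at hs
          simp [max_eq_right (show x - s ≤ 0 by linarith [hs.1])]
      rw [z, add_zero]
      refine intervalIntegral.integral_congr ?_
      intro s hs
      rw [uIcc_of_le hx.1] at hs
      simp [max_eq_left (show 0 ≤ x - s by linarith [hs.2])]
    simp only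
    rw [e1, ← e3, e2, ← intervalIntegral.integral_const_mul, ← intervalIntegral.integral_sub]
    · congr 1; ext s; unfold gk; ring
    · exact cm.intervalIntegrable _ _
    · exact Continuous.intervalIntegrable (by fun_prop) _ _

lemma const_of_orth {v : ℝ → ℝ} (hv : Continuous v) (hv1 : v a = v (a+1))
    (H : ∀ χ : ℝ → ℝ, Continuous χ → Per1 χ → ∫ s in a..(a+1), χ s = 0 →
      ∫ s in a..(a+1), v s * χ s = 0) : ∃ c, ∀ x ∈ Icc a (a+1), v x = c := by
  set c := ∫ s in a..(a+1), v s with hc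
  set χ : ℝ → ℝ := fun x => v (a + Int.fract (x - a)) - c with hχ
  have cχ : Continuous χ := by
    have h1 : Continuous ((fun y => v (a + y)) ∘ Int.fract) :=
      ContinuousOn.comp_fract'' (by fun_prop) (by simpa using hv1)
    have h2 : Continuous (fun x : ℝ => x - a) := by fun_prop
    exact (h1.comp h2).sub continuous_const
  have pχ : Per1 χ := by
    intro x
    simp only [hχ]
    rw [show x + 1 - a = (x - a) + 1 by ring, Int.fract_add_one]
  have eχ : ∀ x ∈ Icc a (a+1), χ x = v x - c := by
    intro x hx
    simp only [hχ]
    rcases eq_or_lt_of_le hx.2 with h | h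
    · subst h
      simp [hv1]
    · rw [Int.fract_eq_self.2 ⟨by linarith [hx.1], by linarith⟩]; simp
  have hle : a ≤ a + 1 := by linarith
  have i0 : ∫ s in a..(a+1), χ s = 0 := by
    rw [intervalIntegral.integral_congr (g := fun s => v s - c)
      (fun s hs => eχ s (by rwa [uIcc_of_le hle] at hs)),
      intervalIntegral.integral_sub (hv.intervalIntegrable _ _) (by simp)]
    simp [hc]
  have h1 := H χ cχ pχ i0
  have h2 : ∫ s in a..(a+1), χ s ^ 2 = 0 := by
    have : ∫ s in a..(a+1), χ s ^ 2 = (∫ s in a..(a+1), v s * χ s) - c * ∫ s in a..(a+1), χ s := by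
      rw [← intervalIntegral.integral_const_mul, ← intervalIntegral.integral_sub]
      · refine intervalIntegral.integral_congr fun s hs => ?_
        have := eχ s (by rwa [uIcc_of_le hle] at hs)
        rw [this]; ring
      · exact (hv.mul cχ).intervalIntegrable _ _
      · exact (continuous_const.mul cχ).intervalIntegrable _ _
    rw [this, h1, i0]; simp
  refine ⟨c, fun x hx => ?_⟩
  by_contra hne
  have hpos : 0 < ∫ s in a..(a+1), χ s ^ 2 := by
    refine intervalIntegral.integral_pos (by linarith) (cχ.pow 2).continuousOn
      (fun s _ => sq_nonneg _) ⟨x, hx, ?_⟩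
    rw [eχ x hx]
    have : v x - c ≠ 0 := sub_ne_zero.2 hne
    positivity
  linarith

end testfn

lemma int_tI {f : ℝ → ℝ} (hp : Per1 f) (a : ℝ) : ∫ x in tI, f x = ∫ x in a..(a+1), f x := by
  have hp' : Function.Periodic f 1 := hp
  rw [hp'.intervalIntegral_add_eq a (-(1/2)), intervalIntegral.integral_of_le (by norm_num)]
  unfold tI; norm_num

/-- Reduction modulo one to `[a, a+1)`. -/
def red (a x : ℝ) : ℝ := a + Int.fract (x - a)

lemma red_meas (a : ℝ) : Measurable (red a) := by
  unfold red
  exact measurable_const.add (measurable_fract.comp (measurable_id.sub_const a))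

lemma red_mem (a x : ℝ) : red a x ∈ Icc a (a+1) :=
  ⟨by unfold red; linarith [Int.fract_nonneg (x - a)], by unfold red; linarith [Int.fract_lt_one (x - a)]⟩

lemma red_eq (a x : ℝ) : red a x = x - (⌊x - a⌋ : ℝ) := by
  unfold red Int.fract; ring

lemma per_red {f : ℝ → ℝ} (hp : Per1 f) (a x : ℝ) : f (red a x) = f x := by
  have hp' : Function.Periodic f 1 := hp
  rw [red_eq]
  simpa using hp'.sub_zsmul_eq (x := x) ⌊x - a⌋

lemma int_red {f : ℝ → ℝ} (hf : Continuous f) (hp : Per1 f) (a : ℝ) (m : Measure ℝ) :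
    ∫ x, f x ∂(m.map (red a)) = ∫ x, f x ∂m := by
  rw [integral_map (red_meas a).aemeasurable hf.aestronglyMeasurable]
  congr 1; ext x; exact per_red hp a x

lemma ae_red (a : ℝ) (m : Measure ℝ) : ∀ᵐ x ∂(m.map (red a)), x ∈ Icc a (a+1) := by
  exact (ae_map_iff (p := fun x => x ∈ Icc a (a+1)) (red_meas a).aemeasurable measurableSet_Icc).2
    (Eventually.of_forall fun x => red_mem a x)

lemma red_atom (a : ℝ) (m : Measure ℝ) (h : ∀ x, m {x} = 0) (s : ℝ) : m.map (red a) {s} = 0 := by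
  rw [Measure.map_apply (red_meas a) (measurableSet_singleton s)]
  have : NullSingletonClass m := ⟨h⟩
  refine measure_mono_null (t := range fun n : ℤ => s + (n:ℝ)) ?_ ((countable_range _).measure_zero m)
  intro x hx
  refine ⟨⌊x - a⌋, ?_⟩
  have : red a x = s := hx
  rw [red_eq] at this
  simp only; linarith

lemma ae_vol (a : ℝ) : ∀ᵐ x ∂(volume.restrict (Ioc a (a+1))), x ∈ Icc a (a+1) := by
  filter_upwards [ae_restrict_mem measurableSet_Ioc] with x hx using ⟨hx.1.le, hx.2⟩

lemma representation {μ ε : ℝ} (hμ : 0 < μ) {K θ : ℝ → ℝ} {m : Measure ℝ} [IsProbabilityMeasure m]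
    (hK : Continuous K) (pK : Per1 K) (hθ : Continuous θ) (pθ : Per1 θ)
    (hE : ∀ φ : ℝ → ℝ, ContDiff ℝ 2 φ → Per1 φ →
    -(μ * ∫ x in tI, θ x * deriv (deriv φ) x) =
      (∫ x in tI, θ x * (K x - θ x) * φ x) - ε * ∫ x, θ x * φ x ∂m) (a : ℝ) :
    ∃ c, ∀ x ∈ Icc a (a+1), θ x =
      pot a (volume.restrict (Ioc a (a+1))) (fun x => -(1/μ) * (θ x * (K x - θ x))) x
      + pot a (m.map (red a)) (fun x => ε / μ * θ x) x + c := by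
  set w1 : ℝ → ℝ := fun x => -(1/μ) * (θ x * (K x - θ x)) with hw1
  set w2 : ℝ → ℝ := fun x => ε / μ * θ x with hw2
  have c1 : Continuous w1 := by fun_prop
  have c2 : Continuous w2 := by fun_prop
  obtain ⟨C1, b1⟩ := per_cont_bdd c1 (fun x => by simp only [hw1, pK x, pθ x])
  obtain ⟨C2, b2⟩ := per_cont_bdd c2 (fun x => by simp only [hw2, pθ x])
  have : IsProbabilityMeasure (m.map (red a)) :=
    Measure.isProbabilityMeasure_map (red_meas a).aemeasurable
  have a1 := ae_vol a
  have a2 := ae_red a m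
  have k1 := pot_continuous a1 c1 b1
  have k2 := pot_continuous a2 c2 b2
  suffices H : ∃ c, ∀ x ∈ Icc a (a+1), θ x - pot a (volume.restrict (Ioc a (a+1))) w1 x
      - pot a (m.map (red a)) w2 x = c by
    obtain ⟨c, hc⟩ := H
    exact ⟨c, fun x hx => by have := hc x hx; linarith⟩
  refine const_of_orth (a := a) (v := fun x => θ x - pot a (volume.restrict (Ioc a (a+1))) w1 x
      - pot a (m.map (red a)) w2 x) ((hθ.sub k1).sub k2)
      (by simp only [pot_left a _ _ a1, pot_left a _ _ a2, pot_right a _ _ a1, pot_right a _ _ a2, pθ a]) ?_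
  intro χ hχ pχ iχ
  obtain ⟨D, hD⟩ := per_cont_bdd hχ pχ
  obtain ⟨φ, f1, f2, f3, f4⟩ := exists_test hχ pχ iχ
  have cφ := f1.continuous
  have E := hE φ f1 f2
  rw [f3, int_tI (a := a) (fun x => by rw [pθ x, pχ x]),
    int_tI (a := a) (fun x => by simp only [pθ x, f2 x, pK x]),
    ← int_red (f := fun x => θ x * φ x) (hθ.mul cφ) (fun x => by simp only [pθ x, f2 x]) a m] at E
  have F1 := pot_fubini a1 c1 b1 hχ hD
  have F2 := pot_fubini a2 c2 b2 hχ hD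
  have G1 : ∫ x, w1 x * (∫ s in a..(a+1), gk a x s * χ s) ∂(volume.restrict (Ioc a (a+1)))
      = -(1/μ) * ∫ x in a..(a+1), θ x * (K x - θ x) * φ x := by
    rw [intervalIntegral.integral_of_le (by linarith), ← integral_const_mul]
    refine integral_congr_ae ?_
    filter_upwards [a1] with x hx
    rw [← f4 x hx]; simp only [hw1]; ring
  have G2 : ∫ x, w2 x * (∫ s in a..(a+1), gk a x s * χ s) ∂(m.map (red a))
      = ε / μ * ∫ x, θ x * φ x ∂(m.map (red a)) := by
    rw [← integral_const_mul]
    refine integral_congr_ae ?_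
    filter_upwards [a2] with x hx
    rw [← f4 x hx]; simp only [hw2]; ring
  have e : ∫ s in a..(a+1), (θ s - pot a (volume.restrict (Ioc a (a+1))) w1 s
      - pot a (m.map (red a)) w2 s) * χ s = (∫ s in a..(a+1), θ s * χ s)
      - (∫ s in a..(a+1), pot a (volume.restrict (Ioc a (a+1))) w1 s * χ s)
      - ∫ s in a..(a+1), pot a (m.map (red a)) w2 s * χ s := by
    rw [← intervalIntegral.integral_sub, ← intervalIntegral.integral_sub]
    · congr 1; ext s; ring
    · exact ((hθ.mul hχ).sub (k1.mul hχ)).intervalIntegrable _ _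
    · exact (k2.mul hχ).intervalIntegrable _ _
    · exact (hθ.mul hχ).intervalIntegrable _ _
    · exact (k1.mul hχ).intervalIntegrable _ _
  rw [e, F1, F2, G1, G2]
  field_simp
  linarith

/-- Lemma 6.3: absence of atoms of the equilibrium distribution of
fishermen. If `(λ̄, θ̄, m̄, ū)` solves (MFG_ergo,1D) with `θ̄ ≢ 0`, and (from the weak
KAM characterization) `supp(m̄) ⊆ {θ̄ = ‖θ̄‖_{L^∞(𝕋)}}`, then `m̄` has no atoms;
consequently `θ̄` is `C¹`. -/
theorem no_atoms (μ ε : ℝ) (hμ : 0 < μ) (hε : 0 < ε)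
    (K : ℝ → ℝ) (hK : K1D K)
    (lam : ℝ) (θ u : ℝ → ℝ) (m : Measure ℝ)
    (hsol : IsErgo1DSol μ ε lam K θ u m) (hθne : θ ≠ 0)
    (hKAM : msupp m ⊆ {x | θ x = sSup (θ '' Icc (-(1/2):ℝ) (1/2))}) :
    (∀ x : ℝ, m {x} = 0) ∧ ContDiff ℝ 1 θ := by
  obtain ⟨pθ, cθ, nθ, -, -, -, -, hm, -, -, -, -, hE⟩ := hsol
  have cK : Continuous K := hK.1.continuous
  have pK : Per1 K := hK.2.1
  have hrep := representation hμ cK pK cθ pθ hE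
  set w1 : ℝ → ℝ := fun x => -(1/μ) * (θ x * (K x - θ x)) with hw1
  set w2 : ℝ → ℝ := fun x => ε / μ * θ x with hw2
  have c1 : Continuous w1 := by fun_prop
  have c2 : Continuous w2 := by fun_prop
  obtain ⟨C1, b1⟩ := per_cont_bdd c1 (fun x => by simp only [hw1, pK x, pθ x])
  obtain ⟨C2, b2⟩ := per_cont_bdd c2 (fun x => by simp only [hw2, pθ x])
  have hP : ∀ a, IsProbabilityMeasure (m.map (red a)) := fun a =>
    Measure.isProbabilityMeasure_map (red_meas a).aemeasurable
  have v0 : ∀ a s : ℝ, (volume.restrict (Ioc a (a+1))) {s} = 0 := fun a s => measure_singleton s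
  have hmax : ∀ x, θ x ≤ sSup (θ '' Icc (-(1/2):ℝ) (1/2)) := by
    intro x
    have := red_mem (-(1/2)) x
    rw [← per_red pθ (-(1/2)) x]
    refine le_csSup (isCompact_Icc.bddAbove_image cθ.continuousOn) ⟨_, ⟨this.1, ?_⟩, rfl⟩
    linarith [this.2]
  have hatom : ∀ x : ℝ, m {x} = 0 := by
    intro x0
    by_contra hx0
    have hs : x0 ∈ msupp m := fun U _ hxU =>
      lt_of_lt_of_le (pos_iff_ne_zero.2 hx0) (measure_mono (singleton_subset_iff.2 hxU))
    have hM : θ x0 = sSup (θ '' Icc (-(1/2):ℝ) (1/2)) := hKAM hs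
    have hM0 : 0 < θ x0 := by
      obtain ⟨y, hy⟩ := Function.ne_iff.1 hθne
      have h1 : 0 < θ y := lt_of_le_of_ne (nθ y) (Ne.symm hy)
      rw [hM]; exact h1.trans_le (hmax y)
    set a := x0 - 1/2 with ha
    obtain ⟨c, hc⟩ := hrep a
    have := hP a
    have hr : red a x0 = x0 := by
      unfold red
      rw [Int.fract_eq_self.2 ⟨by rw [ha]; linarith, by rw [ha]; linarith⟩]; ring
    have hpos : 0 < (m.map (red a)).real {x0} := by
      refine ENNReal.toReal_pos ?_ (measure_ne_top _ _)
      rw [Measure.map_apply (red_meas a) (measurableSet_singleton _)]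
      intro h
      exact hx0 (measure_mono_null (by simpa using hr) h)
    set β := w2 x0 * (m.map (red a)).real {x0} with hβ
    have β0 : 0 < β := by
      have : 0 < w2 x0 := by simp only [hw2]; positivity
      positivity
    set W := pot a (volume.restrict (Ioc a (a+1))) w1 with hW
    have dW : HasDerivAt W (dpot a (volume.restrict (Ioc a (a+1))) w1 x0) x0 :=
      pot_hasDerivAt (ae_vol a) c1 b1 (v0 a x0)
    have dq : HasDerivAt (fun h : ℝ => W (x0 + h) + W (x0 - h)) 0 0 := by
      have e1 : HasDerivAt (fun h : ℝ => W (x0 + h)) (dpot a (volume.restrict (Ioc a (a+1))) w1 x0) 0 := by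
        refine HasDerivAt.comp_const_add x0 0 ?_
        simpa using dW
      have e2 : HasDerivAt (fun h : ℝ => W (x0 - h)) (-dpot a (volume.restrict (Ioc a (a+1))) w1 x0) 0 := by
        refine HasDerivAt.comp_const_sub x0 0 ?_
        simpa using dW
      have e3 := e1.add e2
      rw [add_neg_cancel] at e3
      exact e3
    have key : ∀ h ∈ Ioo (0:ℝ) (1/2), W (x0+h) + W (x0-h) - 2 * W x0 ≤ - (h * β) := by
      intro h hh
      have t1 := hc (x0+h) ⟨by rw [ha]; linarith [hh.1], by rw [ha]; linarith [hh.2]⟩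
      have t2 := hc (x0-h) ⟨by rw [ha]; linarith [hh.2], by rw [ha]; linarith [hh.1]⟩
      have t3 := hc x0 ⟨by rw [ha]; linarith, by rw [ha]; linarith⟩
      have s1 := hmax (x0+h)
      have s2 := hmax (x0-h)
      rw [← hM] at s1 s2
      have := pot_second (ae_red a m) c2 b2
        (fun x => mul_nonneg (by positivity) (nθ x)) x0 hh.1
      linarith
    have lim := dq.tendsto_slope_zero_right
    have : (0:ℝ) ≤ -β := by
      refine le_of_tendsto lim ?_
      filter_upwards [Ioo_mem_nhdsGT (show (0:ℝ) < 1/2 by norm_num)] with h hh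
      have := key h hh
      simp only [zero_add, add_zero, sub_zero, smul_eq_mul]
      rw [inv_mul_le_iff₀ hh.1]
      linarith
    linarith
  refine ⟨hatom, ?_⟩
  set dθ : ℝ → ℝ → ℝ := fun a x => dpot a (volume.restrict (Ioc a (a+1))) w1 x
      + dpot a (m.map (red a)) w2 x with hdθ
  have hd : ∀ a, ∀ x ∈ Ioo a (a+1), HasDerivAt θ (dθ a x) x := by
    intro a x hx
    have := hP a
    obtain ⟨c, hc⟩ := hrep a
    have d := ((pot_hasDerivAt (ae_vol a) c1 b1 (v0 a x)).add
      (pot_hasDerivAt (ae_red a m) c2 b2 (red_atom a m hatom x))).add_const c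
    refine d.congr_of_eventuallyEq ?_
    filter_upwards [Ioo_mem_nhds hx.1 hx.2] with y hy
    exact hc y ⟨hy.1.le, hy.2.le⟩
  rw [contDiff_one_iff_deriv]
  have hmem : ∀ x : ℝ, x ∈ Ioo (x - 1/2) (x - 1/2 + 1) := fun x => ⟨by linarith, by linarith⟩
  refine ⟨fun x => (hd _ x (hmem x)).differentiableAt, ?_⟩
  rw [continuous_iff_continuousAt]
  intro x
  have := hP (x - 1/2)
  have cd : ContinuousAt (dθ (x - 1/2)) x :=
    (dpot_continuousAt (ae_vol _) c1 b1 (v0 _ x)).add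
      (dpot_continuousAt (ae_red _ m) c2 b2 (red_atom _ m hatom x))
  refine cd.congr ?_
  filter_upwards [Ioo_mem_nhds (hmem x).1 (hmem x).2] with y hy
  exact (hd _ y hy).deriv.symm

end
end

section
/- The support of the equilibrium distribution of fishermen is a symmetric interval: let 𝕋 be identified with (−0.5, 0.5) with periodic boundary conditions and K ∈ C¹(𝕋) be even with ∂_x K < 0 on (0, 0.5). If (λ̄, θ̄, m̄, ū) is a solution of the one-dimensional ergodic system (MFG_ergo,1D) with θ̄ ≢ 0, then there exists y ∈ (0, 0.5] such that supp(m̄) = [−y, y]. -/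
open MeasureTheory Real Set Filter
open scoped Topology

noncomputable section

lemma fub (m : Measure ℝ) [IsProbabilityMeasure m] (hm : m tI = 1) (φ φ' : ℝ → ℝ)
    (hφ : ∀ x, HasDerivAt φ (φ' x) x) (hc : Continuous φ') :
    ∫ x, φ x ∂m = φ (1/2) - ∫ t in (-(1/2):ℝ)..(1/2), φ' t * m.real (Iic t) := by
  have hae : ∀ᵐ x ∂m, x ∈ tI := by
    rw [← prob_compl_eq_zero_iff (by unfold tI; exact measurableSet_Ioc)] at hm
    exact hm
  have hφc : Continuous φ := continuous_iff_continuousAt.2 fun x => (hφ x).continuousAt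
  have h1 : ∀ x ∈ tI, φ (1/2) - φ x
      = ∫ t in Ioc (-(1/2):ℝ) (1/2), (if x ≤ t then φ' t else 0) := by
    intro x hx
    have hx' : -(1/2) < x ∧ x ≤ 1/2 := hx
    have e1 : (fun t => if x ≤ t then φ' t else 0) = (Ici x).indicator φ' := by
      ext t; simp [Set.indicator]
    rw [e1, setIntegral_indicator measurableSet_Ici]
    have e2 : Ioc (-(1/2):ℝ) (1/2) ∩ Ici x = Icc x (1/2) := by
      ext t; simp only [mem_inter_iff, mem_Ioc, mem_Ici, mem_Icc]
      constructor
      · rintro ⟨⟨_, h⟩, h'⟩; exact ⟨h', h⟩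
      · rintro ⟨h', h⟩; exact ⟨⟨by linarith, h⟩, h'⟩
    rw [e2, integral_Icc_eq_integral_Ioc, ← intervalIntegral.integral_of_le hx'.2,
      intervalIntegral.integral_eq_sub_of_hasDerivAt (fun t _ => hφ t) (hc.intervalIntegrable _ _)]
  obtain ⟨C, hC⟩ := (isCompact_Icc (a := (-(1/2):ℝ)) (b := 1/2)).exists_bound_of_continuousOn
    hc.continuousOn
  have hint : Integrable (Function.uncurry fun x t => if x ≤ t then φ' t else 0)
      (m.prod (volume.restrict (Ioc (-(1/2):ℝ) (1/2)))) := by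
    have hmeas : Measurable (Function.uncurry fun x t : ℝ => if x ≤ t then φ' t else 0) := by
      apply Measurable.ite (measurableSet_le measurable_fst measurable_snd)
      · exact hc.measurable.comp measurable_snd
      · exact measurable_const
    have hdom : Integrable (fun p : ℝ × ℝ => ‖φ' p.2‖)
      (m.prod (volume.restrict (Ioc (-(1/2):ℝ) (1/2)))) := by
      have : Integrable (fun t => ‖φ' t‖) (volume.restrict (Ioc (-(1/2):ℝ) (1/2))) :=
        (hc.norm.integrableOn_Icc (a := -(1/2)) (b := 1/2)).mono_set Ioc_subset_Icc_self
      exact this.comp_snd m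
    refine hdom.mono' hmeas.aestronglyMeasurable (Eventually.of_forall ?_)
    rintro ⟨x, t⟩
    simp only [Function.uncurry]
    split_ifs <;> simp
  have h2 : ∫ x, (φ (1/2) - φ x) ∂m = ∫ t in (-(1/2):ℝ)..(1/2), φ' t * m.real (Iic t) := by
    rw [integral_congr_ae (g := fun x => ∫ t in Ioc (-(1/2):ℝ) (1/2), (if x ≤ t then φ' t else 0))
      (hae.mono fun x hx => h1 x hx), integral_integral_swap hint,
      intervalIntegral.integral_of_le (by norm_num)]
    congr 1; ext t
    have e1 : (fun x => if x ≤ t then φ' t else 0) = (Iic t).indicator (fun _ => φ' t) := by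
      ext x; simp [Set.indicator]
    rw [e1, integral_indicator measurableSet_Iic]
    simp [mul_comm]
  have hφi : Integrable φ m := by
    obtain ⟨C, hC⟩ := (isCompact_Icc (a := (-(1/2):ℝ)) (b := 1/2)).exists_bound_of_continuousOn
      hφc.continuousOn
    exact Integrable.of_bound hφc.aestronglyMeasurable C
      (hae.mono fun x hx => hC x (Ioc_subset_Icc_self hx))
  rw [integral_sub (integrable_const _) hφi] at h2
  simp at h2
  norm_num at *
  linarith

/-- periodic double antiderivative -/
lemma dubois (D : ℝ → ℝ) (hD : ContinuousOn D (Icc (-(1/2)) (1/2))) (hper : D (-(1/2)) = D (1/2))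
    (h : ∀ φ : ℝ → ℝ, ContDiff ℝ 2 φ → Per1 φ →
      ∫ x in (-(1/2):ℝ)..(1/2), D x * deriv (deriv φ) x = 0) :
    ∀ x ∈ Icc (-(1/2):ℝ) (1/2), D x = D (-(1/2)) := by
  set d := ∫ x in (-(1/2):ℝ)..(1/2), D x with hd
  set E : ℝ → ℝ := fun x => D x - d with hE
  have : Fact ((0:ℝ) < 1) := ⟨one_pos⟩
  have hIcc : Icc (-(1/2):ℝ) (-(1/2)+1) = Icc (-(1/2)) (1/2) := by norm_num
  have hDi : IntervalIntegrable D volume (-(1/2)) (1/2) := by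
    apply ContinuousOn.intervalIntegrable; rwa [uIcc_of_le (by norm_num)]
  have hEc : ContinuousOn E (Icc (-(1/2)) (1/2)) := hD.sub continuousOn_const
  set η : ℝ → ℝ := fun x => AddCircle.liftIco 1 (-(1/2):ℝ) E (x : AddCircle (1:ℝ)) with hη
  have hηc : Continuous η := by
    have h0 : Continuous (AddCircle.liftIco 1 (-(1/2):ℝ) E) := by
      apply AddCircle.liftIco_continuous
      · simp only [hE]; rw [hper]; norm_num
      · rw [hIcc]; exact hEc
    exact h0.comp (AddCircle.continuous_mk' (1:ℝ))
  have hηp : Function.Periodic η 1 := by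
    intro x; simp [hη]
  have hηE : ∀ x ∈ Icc (-(1/2):ℝ) (1/2), η x = E x := by
    have key : ∀ x ∈ Ico (-(1/2):ℝ) (1/2), η x = E x := by
      intro x hx
      exact AddCircle.liftIco_coe_apply (by norm_num; norm_num at hx; exact hx)
    intro x hx
    rcases hx.2.lt_or_eq with h' | h'
    · exact key x ⟨hx.1, h'⟩
    · have := hηp (-(1/2))
      rw [key (-(1/2)) ⟨le_refl _, by norm_num⟩] at this
      have h3 : (-(1/2):ℝ) + 1 = 1/2 := by norm_num
      rw [h3] at this
      rw [h', this]; simp only [hE]; rw [hper]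
  have hη0 : ∫ x in (-(1/2):ℝ)..(1/2), η x = 0 := by
    rw [intervalIntegral.integral_congr (g := E)]
    · simp only [hE]
      rw [intervalIntegral.integral_sub hDi (by simp)]
      simp; norm_num
      exact sub_eq_zero.2 hd.symm
    · intro x hx; rw [uIcc_of_le (by norm_num)] at hx; exact hηE x hx
  -- a mean zero periodic function has a periodic antiderivative
  have anti : ∀ f : ℝ → ℝ, Continuous f → Function.Periodic f 1 →
      ∫ x in (-(1/2):ℝ)..(1/2), f x = 0 →
      Function.Periodic (fun x => ∫ t in (-(1/2):ℝ)..x, f t) 1 := by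
    intro f hf hfp hf0 x
    have h1 := hfp.intervalIntegral_add_eq x (-(1/2))
    have h2 := intervalIntegral.integral_add_adjacent_intervals
      (hf.intervalIntegrable (μ := volume) (-(1/2)) x) (hf.intervalIntegrable x (x+1))
    have h3 : (-(1/2):ℝ) + 1 = 1/2 := by norm_num
    rw [h3, hf0] at h1
    simp only; rw [← h2, h1, add_zero]
  set ψ0 : ℝ → ℝ := fun x => ∫ t in (-(1/2):ℝ)..x, η t with hψ0
  have hψ0d : ∀ x, HasDerivAt ψ0 (η x) x := fun x =>
    (hηc.integral_hasStrictDerivAt (-(1/2)) x).hasDerivAt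
  have hψ0c : Continuous ψ0 := continuous_iff_continuousAt.2 fun x => (hψ0d x).continuousAt
  have hψ0p : Function.Periodic ψ0 1 := anti η hηc hηp hη0
  set k := ∫ x in (-(1/2):ℝ)..(1/2), ψ0 x with hk
  set ψ : ℝ → ℝ := fun x => ψ0 x - k with hψ
  have hψd : ∀ x, HasDerivAt ψ (η x) x := fun x => (hψ0d x).sub_const k
  have hψc : Continuous ψ := hψ0c.sub continuous_const
  have hψp : Function.Periodic ψ 1 := fun x => by simp only [hψ]; rw [hψ0p x]
  have hψ00 : ∫ x in (-(1/2):ℝ)..(1/2), ψ x = 0 := by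
    simp only [hψ]
    rw [intervalIntegral.integral_sub (hψ0c.intervalIntegrable _ _) (by simp)]
    simp; norm_num
    exact sub_eq_zero.2 hk.symm
  set φ : ℝ → ℝ := fun x => ∫ t in (-(1/2):ℝ)..x, ψ t with hφ
  have hφd : ∀ x, HasDerivAt φ (ψ x) x := fun x =>
    (hψc.integral_hasStrictDerivAt (-(1/2)) x).hasDerivAt
  have hφp : Per1 φ := anti ψ hψc hψp hψ00
  have dφ : deriv φ = ψ := funext fun x => (hφd x).deriv
  have dψ : deriv ψ = η := funext fun x => (hψd x).deriv
  have hC1 : ContDiff ℝ 1 ψ := by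
    rw [contDiff_one_iff_deriv, dψ]
    exact ⟨fun x => (hψd x).differentiableAt, hηc⟩
  have hC2 : ContDiff ℝ 2 φ := by
    have : (2 : WithTop ℕ∞) = 1 + 1 := by norm_num
    rw [this, contDiff_succ_iff_deriv, dφ]
    exact ⟨fun x => (hφd x).differentiableAt, by simp, hC1⟩
  have hz := h φ hC2 hφp
  rw [dφ, dψ] at hz
  have hsq : ∫ x in (-(1/2):ℝ)..(1/2), η x * η x = 0 := by
    have : ∫ x in (-(1/2):ℝ)..(1/2), η x * η x =
        ∫ x in (-(1/2):ℝ)..(1/2), (D x * η x - d * η x) := by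
      apply intervalIntegral.integral_congr
      intro x hx; rw [uIcc_of_le (by norm_num)] at hx
      simp only
      have := hηE x hx
      simp only [hE] at this
      rw [← sub_mul, ← this]
    rw [this, intervalIntegral.integral_sub, hz, intervalIntegral.integral_const_mul, hη0]
    · simp
    · exact hDi.mul_continuousOn hηc.continuousOn
    · exact (hηc.intervalIntegrable _ _).const_mul d
  have hEz : ∀ x ∈ Icc (-(1/2):ℝ) (1/2), D x = d := by
    intro x hx
    by_contra hne
    have hne' : η x ≠ 0 := by
      rw [hηE x hx]; simp only [hE]; exact sub_ne_zero.2 hne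
    have := intervalIntegral.integral_pos (f := fun x => η x * η x) (a := -(1/2)) (b := 1/2)
      (by norm_num) (hηc.mul hηc).continuousOn (fun x _ => mul_self_nonneg _)
      ⟨x, hx, mul_self_pos.2 hne'⟩
    linarith
  intro x hx
  rw [hEz x hx, hEz _ (by norm_num)]

lemma reg (μ e : ℝ) (θ g : ℝ → ℝ) (hθ : Continuous θ) (hg : Continuous g) (hp : Per1 θ)
    (m : Measure ℝ) [IsProbabilityMeasure m] (hm : m tI = 1)
    (hw : ∀ φ : ℝ → ℝ, ContDiff ℝ 2 φ → Per1 φ →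
      -(μ * ∫ x in tI, θ x * deriv (deriv φ) x) = (∫ x in tI, g x * φ x) - e * ∫ x, φ x ∂m) :
    (∫ x in (-(1/2):ℝ)..(1/2), g x) = e ∧ ∃ c, ∀ x ∈ Icc (-(1/2):ℝ) (1/2),
      μ * (θ x - θ (-(1/2))) =
        ∫ z in (-(1/2):ℝ)..x, (e * m.real (Iic z) - (∫ w in (-(1/2):ℝ)..z, g w) + c) := by
  have htI : ∀ f : ℝ → ℝ, ∫ x in tI, f x = ∫ x in (-(1/2):ℝ)..(1/2), f x := fun f => by
    rw [intervalIntegral.integral_of_le (by norm_num)]; rfl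
  simp only [htI] at hw
  have hge : (∫ x in (-(1/2):ℝ)..(1/2), g x) = e := by
    have := hw (fun _ => 1) contDiff_const (fun _ => rfl)
    simp at this
    norm_num at *
    linarith
  refine ⟨hge, ?_⟩
  set A : ℝ → ℝ := fun z => ∫ w in (-(1/2):ℝ)..z, g w with hA
  have hAd : ∀ x, HasDerivAt A (g x) x := fun x =>
    (hg.integral_hasStrictDerivAt (-(1/2)) x).hasDerivAt
  have hAc : Continuous A := continuous_iff_continuousAt.2 fun x => (hAd x).continuousAt
  set F : ℝ → ℝ := fun z => m.real (Iic z) with hF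
  have hFcdf : F = ProbabilityTheory.cdf m := by
    ext z; rw [ProbabilityTheory.cdf_eq_real]
  have hFm : Monotone F := by rw [hFcdf]; exact ProbabilityTheory.monotone_cdf m
  have hFr : ∀ x, ContinuousWithinAt F (Ici x) x := by
    rw [hFcdf]; exact fun x => (ProbabilityTheory.cdf m).right_continuous x
  set P : ℝ → ℝ := fun z => e * F z - A z with hP
  have hFi : ∀ a b, IntervalIntegrable F volume a b := fun a b => hFm.intervalIntegrable
  have hPi : ∀ a b, IntervalIntegrable P volume a b := fun a b =>
    ((hFi a b).const_mul e).sub (hAc.intervalIntegrable a b)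
  set c : ℝ := -∫ x in (-(1/2):ℝ)..(1/2), P x with hc
  have hRi : ∀ a b, IntervalIntegrable (fun z => P z + c) volume a b := fun a b =>
    (hPi a b).add (by simp)
  refine ⟨c, ?_⟩
  set B : ℝ → ℝ := fun x => ∫ z in (-(1/2):ℝ)..x, (P z + c) with hB
  have hBc : Continuous B := intervalIntegral.continuous_primitive hRi _
  have hB0 : B (-(1/2)) = 0 := by simp [hB]
  have hB1 : B (1/2) = 0 := by
    simp only [hB]
    rw [intervalIntegral.integral_add (hPi _ _) (by simp)]
    simp [hc]; norm_num
  have hRmeas : Measurable (fun z => P z + c) :=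
    (((hFm.measurable).const_mul e).sub hAc.measurable).add_const c
  have hBd : ∀ x, HasDerivWithinAt B (P x + c) (Ioi x) x := by
    intro x
    have hcont : ContinuousWithinAt (fun z => P z + c) (Ioi x) x :=
      ((((hFr x).mono Ioi_subset_Ici_self).const_mul e).sub
        hAc.continuousWithinAt).add continuousWithinAt_const
    exact intervalIntegral.integral_hasDerivWithinAt_right (hRi _ _) (t := Ioi x)
      (hRmeas.stronglyMeasurable.stronglyMeasurableAtFilter) hcont |>.mono Ioi_subset_Ici_self
  have key := dubois (fun x => μ * θ x - B x) (by fun_prop) (by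
      rw [hB0, hB1]
      have := hp (-(1/2)); norm_num at this ⊢; left; exact this.symm) ?_
  · intro x hx
    have := key x hx
    rw [hB0] at this
    change _ = B x
    linarith
  · intro φ hφ hφp
    have hd1 : ContDiff ℝ 1 (deriv φ) := by
      have h2 : (2 : WithTop ℕ∞) = 1 + 1 := by norm_num
      rw [h2, contDiff_succ_iff_deriv] at hφ
      exact hφ.2.2
    have hd2 : Continuous (deriv (deriv φ)) := (contDiff_one_iff_deriv.1 hd1).2
    have hφd : ∀ x, HasDerivAt φ (deriv φ x) x := fun x =>
      (hφ.differentiable (by norm_num) x).hasDerivAt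
    have hφ'd : ∀ x, HasDerivAt (deriv φ) (deriv (deriv φ) x) x := fun x =>
      (hd1.differentiable (by norm_num) x).hasDerivAt
    have hd1c := hd1.continuous
    have e1 := hw φ hφ hφp
    rw [fub m hm φ (deriv φ) hφd hd1c] at e1
    have hφper : φ (-(1/2)) = φ (1/2) := by
      have := hφp (-(1/2)); norm_num at this ⊢; exact this.symm
    have e2 : ∫ x in (-(1/2):ℝ)..(1/2), g x * φ x
        = e * φ (1/2) - ∫ x in (-(1/2):ℝ)..(1/2), A x * deriv φ x := by
      have := intervalIntegral.integral_mul_deriv_eq_deriv_mul (a := -(1/2)) (b := 1/2)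
        (fun x _ => hAd x) (fun x _ => hφd x) (hg.intervalIntegrable _ _)
        (hd1c.intervalIntegrable _ _)
      have hA0 : A (-(1/2)) = 0 := by simp [hA]
      have hA1 : A (1/2) = e := hge
      rw [hA0, hA1] at this
      linarith
    have e3 : ∫ x in (-(1/2):ℝ)..(1/2), B x * deriv (deriv φ) x
        = - ∫ x in (-(1/2):ℝ)..(1/2), (P x + c) * deriv φ x := by
      have := intervalIntegral.integral_mul_deriv_eq_deriv_mul_of_hasDeriv_right (a := -(1/2)) (b := 1/2)
        hBc.continuousOn hd1c.continuousOn (fun x _ => hBd x)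
        (fun x _ => (hφ'd x).hasDerivWithinAt) (hRi _ _) (hd2.intervalIntegrable _ _)
      rw [hB0, hB1] at this
      linarith
    have e4 : ∫ x in (-(1/2):ℝ)..(1/2), (P x + c) * deriv φ x
        = e * (∫ x in (-(1/2):ℝ)..(1/2), deriv φ x * F x)
          - ∫ x in (-(1/2):ℝ)..(1/2), A x * deriv φ x := by
      have e5 : ∫ x in (-(1/2):ℝ)..(1/2), deriv φ x = 0 := by
        rw [intervalIntegral.integral_eq_sub_of_hasDerivAt (fun t _ => hφd t)
          (hd1c.intervalIntegrable _ _), hφper, sub_self]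
      have : ∀ x, (P x + c) * deriv φ x
          = e * (deriv φ x * F x) - A x * deriv φ x + c * deriv φ x := by
        intro x; simp only [hP]; ring
      simp only [this]
      have i1 : IntervalIntegrable (fun x => e * (deriv φ x * F x)) volume (-(1/2)) (1/2) :=
        ((hFi _ _).continuousOn_mul hd1c.continuousOn).const_mul e
      have i2 : IntervalIntegrable (fun x => A x * deriv φ x) volume (-(1/2)) (1/2) :=
        (hAc.mul hd1c).intervalIntegrable _ _
      have i3 : IntervalIntegrable (fun x => c * deriv φ x) volume (-(1/2)) (1/2) :=
        (continuous_const.mul hd1c).intervalIntegrable _ _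
      rw [intervalIntegral.integral_add (i1.sub i2) i3, intervalIntegral.integral_sub i1 i2,
        intervalIntegral.integral_const_mul, intervalIntegral.integral_const_mul, e5]
      ring
    have i1 : IntervalIntegrable (fun x => θ x * deriv (deriv φ) x) volume (-(1/2)) (1/2) :=
        (hθ.mul hd2).intervalIntegrable _ _
    have i2 : IntervalIntegrable (fun x => B x * deriv (deriv φ) x) volume (-(1/2)) (1/2) :=
        (hBc.mul hd2).intervalIntegrable _ _
    simp only [sub_mul, mul_assoc]
    rw [intervalIntegral.integral_sub (i1.const_mul μ) i2, intervalIntegral.integral_const_mul]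
    rw [e3, e4]
    rw [e2] at e1
    linarith

lemma ddR (Q h : ℝ → ℝ) (hQ : Continuous Q) (hh : Continuous h) (p r : ℝ) (hpr : p < r)
    (hp : 0 < h p) (hQp : 0 ≤ Q p)
    (hi : ∀ x ∈ Ioo p r, ∫ z in p..x, h z ≤ Q x - Q p) :
    ∃ y ∈ Ioo p r, 0 < ∫ z in p..y, Q z := by
  have hev : ∀ᶠ x in 𝓝 p, 0 < h x := hh.continuousAt.eventually (lt_mem_nhds hp)
  obtain ⟨δ, hδ, hball⟩ := Metric.eventually_nhds_iff.1 hev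
  set y := min (p + δ/2) ((p+r)/2) with hy
  have hpy : p < y := lt_min (by linarith) (by linarith)
  have hyr : y < r := lt_of_le_of_lt (min_le_right _ _) (by linarith)
  have hyδ : y ≤ p + δ/2 := min_le_left _ _
  refine ⟨y, ⟨hpy, hyr⟩, ?_⟩
  refine intervalIntegral.intervalIntegral_pos_of_pos_on (hQ.intervalIntegrable _ _) ?_ hpy
  intro x hx
  have h1 : 0 < ∫ z in p..x, h z := by
    refine intervalIntegral.intervalIntegral_pos_of_pos_on (hh.intervalIntegrable _ _) ?_ hx.1
    intro z hz
    apply hball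
    rw [Real.dist_eq, abs_of_pos (by linarith [hz.1])]
    linarith [hz.2, hx.2]
  linarith [hi x ⟨hx.1, by linarith [hx.2]⟩]

lemma ddL (Q h : ℝ → ℝ) (hQ : Continuous Q) (hh : Continuous h) (p r : ℝ) (hpr : r < p)
    (hp : 0 < h p) (hQp : Q p ≤ 0)
    (hi : ∀ x ∈ Ioo r p, ∫ z in x..p, h z ≤ Q p - Q x) :
    ∃ y ∈ Ioo r p, ∫ z in y..p, Q z < 0 := by
  obtain ⟨y, hy, hpos⟩ := ddR (fun x => - Q (-x)) (fun x => h (-x)) (by fun_prop) (by fun_prop)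
    (-p) (-r) (by linarith) (by simpa using hp) (by simpa using hQp) (by
      intro x hx
      rw [intervalIntegral.integral_comp_neg]
      have := hi (-x) ⟨by linarith [hx.2], by linarith [hx.1]⟩
      simp only [neg_neg]; linarith)
  refine ⟨-y, ⟨by linarith [hy.2], by linarith [hy.1]⟩, ?_⟩
  rw [intervalIntegral.integral_neg, intervalIntegral.integral_comp_neg] at hpos
  simp only [neg_neg] at hpos; linarith

lemma Kmin (K : ℝ → ℝ) (hKe : ∀ x, K (-x) = K x) (hKs : StrictAntiOn K (Icc 0 (1/2)))
    (p q x M : ℝ) (hp : -(1/2) ≤ p) (hq : q ≤ 1/2) (hpx : p < x) (hxq : x < q)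
    (h1 : M ≤ K p) (h2 : M ≤ K q) : M < K x := by
  have hKa : ∀ x, K |x| = K x := fun x => by
    rcases abs_choice x with h | h <;> rw [h]
    exact hKe x
  have hb : |x| ≤ 1/2 := abs_le.2 ⟨by linarith, by linarith⟩
  rcases le_total 0 x with h | h
  · have := hKs (a := x) (b := q) ⟨h, by linarith⟩ ⟨by linarith, hq⟩ hxq
    linarith
  · have := hKs (a := -x) (b := -p) ⟨by linarith, by linarith⟩ ⟨by linarith, by linarith⟩
      (by linarith)
    rw [hKe, hKe] at this
    linarith

/-- positivity -/
lemma expo (f f' : ℝ → ℝ) (C a b : ℝ) (hab : a ≤ b) (hf : ContinuousOn f (Icc a b))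
    (hd : ∀ x ∈ Ioo a b, HasDerivAt f (f' x) x) (hb : ∀ x ∈ Ioo a b, |f' x| ≤ C * f x) :
    f b ≤ f a * exp (C * (b - a)) ∧ f a ≤ f b * exp (C * (b - a)) := by
  have hexp : ∀ k x : ℝ, HasDerivAt (fun x => exp (k * x)) (exp (k*x) * k) x := by
    intro k x
    have := ((hasDerivAt_id x).const_mul k).exp
    simpa using this
  constructor
  · have hanti : AntitoneOn (fun x => f x * exp ((-C) * x)) (Icc a b) := by
      have hd2 : ∀ x ∈ interior (Icc a b), HasDerivAt (fun x => f x * exp ((-C) * x))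
          (f' x * exp ((-C) * x) + f x * (exp ((-C)*x) * (-C))) x := by
        intro x hx; rw [interior_Icc] at hx
        exact (hd x hx).mul (hexp (-C) x)
      apply antitoneOn_of_deriv_nonpos (convex_Icc a b)
      · exact hf.mul (by fun_prop)
      · intro x hx; exact (hd2 x hx).differentiableAt.differentiableWithinAt
      · intro x hx; rw [(hd2 x hx).deriv]; rw [interior_Icc] at hx
        have h1 := (abs_le.1 (hb x hx)).2
        have h2 := exp_pos (-C * x)
        nlinarith
    have := hanti (left_mem_Icc.2 hab) (right_mem_Icc.2 hab) hab
    simp only at this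
    have h2 := exp_pos (C * b)
    have h3 := mul_le_mul_of_nonneg_right this h2.le
    rw [mul_assoc, mul_assoc, ← exp_add, ← exp_add] at h3
    have e1 : -C * b + C * b = 0 := by ring
    have e2 : -C * a + C * b = C * (b - a) := by ring
    rw [e1, e2] at h3; simpa using h3
  · have hmono : MonotoneOn (fun x => f x * exp (C * x)) (Icc a b) := by
      have hd2 : ∀ x ∈ interior (Icc a b), HasDerivAt (fun x => f x * exp (C * x))
          (f' x * exp (C * x) + f x * (exp (C*x) * C)) x := by
        intro x hx; rw [interior_Icc] at hx
        exact (hd x hx).mul (hexp C x)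
      apply monotoneOn_of_deriv_nonneg (convex_Icc a b)
      · exact hf.mul (by fun_prop)
      · intro x hx; exact (hd2 x hx).differentiableAt.differentiableWithinAt
      · intro x hx; rw [(hd2 x hx).deriv]; rw [interior_Icc] at hx
        have h1 := (abs_le.1 (hb x hx)).1
        have h2 := exp_pos (C * x)
        nlinarith
    have := hmono (left_mem_Icc.2 hab) (right_mem_Icc.2 hab) hab
    simp only at this
    have h2 := exp_pos (-C * a)
    have h3 := mul_le_mul_of_nonneg_right this h2.le
    rw [mul_assoc, mul_assoc, ← exp_add, ← exp_add] at h3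
    have e1 : C * a + -C * a = 0 := by ring
    have e2 : C * b + -C * a = C * (b - a) := by ring
    rw [e1, e2] at h3; simpa using h3

/-- Reduced one-dimensional problem. -/
structure Core (μ e M c : ℝ) (K θ F : ℝ → ℝ) (S : Set ℝ) : Prop where
  hμ : 0 < μ
  he : 0 < e
  hM : 0 < M
  hKc : Continuous K
  hKe : ∀ x, K (-x) = K x
  hKs : StrictAntiOn K (Icc 0 (1/2))
  hθ : Continuous θ
  hθ0 : ∀ x, 0 ≤ θ x
  hθM : ∀ x, θ x ≤ M
  hθp : θ (-(1/2)) = θ (1/2)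
  hFc : Continuous F
  hFm : Monotone F
  hF0 : F (-(1/2)) = 0
  hF1 : F (1/2) = 1
  hScl : IsClosed S
  hSsub : S ⊆ Icc (-(1/2)) (1/2)
  hgap : ∀ p q, p ≤ q → Ioo p q ∩ S = ∅ → F p = F q
  hsup : ∀ p q, ∀ x ∈ S, p < x → x < q → F p < F q
  hint : ∫ x in (-(1/2):ℝ)..(1/2), θ x * (K x - θ x) = e
  heq : ∀ x ∈ Icc (-(1/2):ℝ) (1/2), μ * (θ x - θ (-(1/2))) =
    ∫ z in (-(1/2):ℝ)..x, (e * F z - (∫ w in (-(1/2):ℝ)..z, θ w * (K w - θ w)) + c)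
  hSM : ∀ x ∈ S, θ x = M
  hQM : ∀ x ∈ S, e * F x - (∫ w in (-(1/2):ℝ)..x, θ w * (K w - θ w)) + c = 0

set_option maxHeartbeats 2000000 in
theorem core {μ e M c : ℝ} {K θ F : ℝ → ℝ} {S : Set ℝ} (H : Core μ e M c K θ F S) :
    ∃ y ∈ Ioc (0:ℝ) (1/2), S = Icc (-y) y := by
  obtain ⟨hμ, he, hM, hKc, hKe, hKs, hθ, hθ0, hθM, hθp, hFc, hFm, hF0, hF1, hScl, hSsub, hgap,
    hsup, hint, heq, hSM, hQM⟩ := H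
  set g : ℝ → ℝ := fun x => θ x * (K x - θ x) with hg
  have hgc : Continuous g := hθ.mul (hKc.sub hθ)
  set A : ℝ → ℝ := fun x => ∫ w in (-(1/2):ℝ)..x, g w with hA
  have hAd : ∀ x, HasDerivAt A (g x) x := fun x =>
    (hgc.integral_hasStrictDerivAt (-(1/2)) x).hasDerivAt
  have hAc : Continuous A := continuous_iff_continuousAt.2 fun x => (hAd x).continuousAt
  have hAi : ∀ x y, ∫ z in x..y, g z = A y - A x := fun x y =>
    (intervalIntegral.integral_interval_sub_left (hgc.intervalIntegrable _ _)
      (hgc.intervalIntegrable _ _)).symm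
  set Q : ℝ → ℝ := fun x => e * F x - A x + c with hQ
  have hQc : Continuous Q := by fun_prop
  have hA0 : A (-(1/2)) = 0 := by simp [hA]
  have hA1 : A (1/2) = e := hint
  have hQp : Q (-(1/2)) = Q (1/2) := by simp only [hQ]; rw [hA0, hA1, hF0, hF1]; ring
  have hQi : ∀ x ∈ Icc (-(1/2):ℝ) (1/2), ∀ y ∈ Icc (-(1/2):ℝ) (1/2),
      ∫ z in x..y, Q z = μ * (θ y - θ x) := by
    intro x hx y hy
    rw [← intervalIntegral.integral_interval_sub_left (a := -(1/2)) (hQc.intervalIntegrable _ _)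
      (hQc.intervalIntegrable _ _)]
    have h1 := heq x hx
    have h2 := heq y hy
    change _ = ∫ z in (-(1/2):ℝ)..x, Q z at h1
    change _ = ∫ z in (-(1/2):ℝ)..y, Q z at h2
    linarith
  have hQS : ∀ x ∈ S, Q x = 0 := hQM
  have hθd : ∀ x ∈ Ioo (-(1/2):ℝ) (1/2), HasDerivAt θ (Q x / μ) x := by
    intro x hx
    have h1 : HasDerivAt (fun x => θ (-(1/2)) + (∫ z in (-(1/2):ℝ)..x, Q z)/μ) (Q x/μ) x :=
      ((hQc.integral_hasStrictDerivAt (-(1/2)) x).hasDerivAt.div_const μ).const_add _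
    refine h1.congr_of_eventuallyEq ?_
    filter_upwards [Ioo_mem_nhds hx.1 hx.2] with y hy
    rw [hQi _ (by norm_num) y ⟨hy.1.le, hy.2.le⟩]
    field_simp; ring
  -- S is nonempty
  have hSne : S.Nonempty := by
    by_contra hne
    rw [not_nonempty_iff_eq_empty] at hne
    have := hgap (-(1/2)) (1/2) (by norm_num) (by simp [hne])
    rw [hF0, hF1] at this; norm_num at this
  have hScpt : IsCompact S := isCompact_Icc.of_isClosed_subset hScl hSsub
  -- no gaps
  have hnogap : ∀ p ∈ S, ∀ q ∈ S, p < q → (Ioo p q ∩ S).Nonempty := by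
    intro p hp q hq hpq
    by_contra hne
    rw [not_nonempty_iff_eq_empty] at hne
    have hpI := hSsub hp
    have hqI := hSsub hq
    have hFpq := hgap p q hpq.le hne
    have hFx : ∀ x, p ≤ x → x ≤ q → F x = F p := fun x h1 h2 =>
      le_antisymm (by rw [hFpq]; exact hFm h2) (hFm h1)
    have hKp : M ≤ K p := by
      by_contra hlt
      push Not at hlt
      obtain ⟨y, hy, hpos⟩ := ddR Q (fun x => - g x) hQc hgc.neg p q hpq
        (by simp only [hg]; rw [hSM p hp]; nlinarith) (hQS p hp).ge (by
          intro x hx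
          rw [intervalIntegral.integral_neg, hAi]
          simp only [hQ]; rw [hFx x hx.1.le hx.2.le]; linarith)
      rw [hQi p hpI y ⟨by linarith [hpI.1, hy.1], by linarith [hqI.2, hy.2]⟩, hSM p hp] at hpos
      nlinarith [hθM y]
    have hKq : M ≤ K q := by
      by_contra hlt
      push Not at hlt
      obtain ⟨y, hy, hpos⟩ := ddL Q (fun x => - g x) hQc hgc.neg q p hpq
        (by simp only [hg]; rw [hSM q hq]; nlinarith) (hQS q hq).le (by
          intro x hx
          rw [intervalIntegral.integral_neg, hAi]
          simp only [hQ]; rw [hFx x hx.1.le hx.2.le, ← hFpq]; linarith)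
      rw [hQi y ⟨by linarith [hpI.1, hy.1], by linarith [hqI.2, hy.2]⟩ q hqI, hSM q hq] at hpos
      nlinarith [hθM y]
    have hKx : ∀ x ∈ Ioo p q, M < K x := fun x hx =>
      Kmin K hKe hKs p q x M hpI.1 hqI.2 hx.1 hx.2 hKp hKq
    have hz : ∫ x in p..q, g x = 0 := by
      rw [hAi]
      have h1 := hQS p hp
      have h2 := hQS q hq
      simp only [hQ] at h1 h2
      rw [hFpq] at h1; linarith
    have hgn : ∀ x ∈ Ioo p q, 0 ≤ g x := fun x hx =>
      mul_nonneg (hθ0 x) (by linarith [hKx x hx, hθM x])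
    have hgq : 0 ≤ g q := mul_nonneg (hθ0 q) (by linarith [hθM q])
    have hev : ∀ᶠ x in 𝓝[>] p, 0 < θ x :=
      (hθ.continuousAt.eventually (lt_mem_nhds (by rw [hSM p hp]; exact hM))).filter_mono
        nhdsWithin_le_nhds
    have hev2 : ∀ᶠ x in 𝓝[>] p, x ∈ Ioo p q := Ioo_mem_nhdsGT hpq
    obtain ⟨x, hx0, hx⟩ := (hev.and hev2).exists
    have := intervalIntegral.integral_pos (f := g) hpq hgc.continuousOn (by
      intro z hz
      rcases hz.2.lt_or_eq with h | h
      · exact hgn z ⟨hz.1, h⟩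
      · rw [h]; exact hgq) ⟨x, ⟨hx.1.le, hx.2.le⟩, mul_pos hx0 (by linarith [hKx x hx, hθM x])⟩
    linarith
  set s := sInf S with hs
  set t := sSup S with ht
  have hsS : s ∈ S := hScpt.sInf_mem hSne
  have htS : t ∈ S := hScpt.sSup_mem hSne
  have hsle : ∀ x ∈ S, s ≤ x := fun x hx => csInf_le hScpt.bddBelow hx
  have htle : ∀ x ∈ S, x ≤ t := fun x hx => le_csSup hScpt.bddAbove hx
  have hsI := hSsub hsS
  have htI := hSsub htS
  have hSst : S = Icc s t := by
    refine Subset.antisymm (fun x hx => ⟨hsle x hx, htle x hx⟩) ?_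
    intro x hx
    by_contra hxS
    have hc1 : IsCompact (S ∩ Iic x) := hScpt.inter_right isClosed_Iic
    have hc2 : IsCompact (S ∩ Ici x) := hScpt.inter_right isClosed_Ici
    have hp := hc1.sSup_mem ⟨s, hsS, hx.1⟩
    have hq := hc2.sInf_mem ⟨t, htS, hx.2⟩
    set p := sSup (S ∩ Iic x)
    set q := sInf (S ∩ Ici x)
    have hpx : p < x := lt_of_le_of_ne hp.2 (fun h => hxS (h ▸ hp.1))
    have hxq : x < q := lt_of_le_of_ne hq.2 (fun h => hxS (h ▸ hq.1))
    obtain ⟨z, hz, hzS⟩ := hnogap p hp.1 q hq.1 (hpx.trans hxq)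
    rcases le_total z x with h | h
    · have := le_csSup hc1.bddAbove (show z ∈ S ∩ Iic x from ⟨hzS, h⟩)
      exact absurd hz.1 (not_lt.2 this)
    · have := csInf_le hc2.bddBelow (show z ∈ S ∩ Ici x from ⟨hzS, h⟩)
      exact absurd hz.2 (not_lt.2 this)
  have hFs : F s = 0 := by
    rw [← hF0]; symm
    apply hgap _ _ hsI.1
    ext x; simp only [mem_inter_iff, mem_Ioo, mem_empty_iff_false, iff_false]
    rintro ⟨⟨_, h⟩, h'⟩; linarith [hsle x h']
  have hFt : F t = 1 := by
    rw [← hF1]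
    apply hgap _ _ htI.2
    ext x; simp only [mem_inter_iff, mem_Ioo, mem_empty_iff_false, iff_false]
    rintro ⟨⟨h, _⟩, h'⟩; linarith [htle x h']
  have hst : s < t := by
    by_contra h
    have := hFm (not_lt.1 h)
    linarith
  -- positivity
  obtain ⟨C, hC⟩ := (isCompact_Icc (a := (-(1/2):ℝ)) (b := 1/2)).exists_bound_of_continuousOn
    ((hKc.sub hθ).continuousOn)
  have hC0 : 0 ≤ C := (norm_nonneg _).trans (hC 0 (by norm_num))
  have hode : ∀ a b, a ≤ b → -(1/2) ≤ a → b ≤ 1/2 → F a = F b →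
      let f := fun x => θ x ^ 2 + Q x ^ 2
      f b ≤ f a * exp ((1/μ + C) * (b - a)) ∧ f a ≤ f b * exp ((1/μ + C) * (b - a)) := by
    intro a b hab ha hb hFab f
    have hFx : ∀ x, a ≤ x → x ≤ b → F x = F a := fun x h1 h2 =>
      le_antisymm (by rw [hFab]; exact hFm h2) (hFm h1)
    have hQd : ∀ x ∈ Ioo a b, HasDerivAt Q (- g x) x := by
      intro x hx
      have h1 : HasDerivAt (fun x => e * F a - A x + c) (- g x) x :=
        ((hAd x).const_sub (e * F a)).add_const c
      refine h1.congr_of_eventuallyEq ?_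
      filter_upwards [Ioo_mem_nhds hx.1 hx.2] with y hy
      simp only [hQ]; rw [hFx y hy.1.le hy.2.le]
    apply expo f (fun x => 2 * θ x * (Q x / μ) + 2 * Q x * (- g x)) _ a b hab
    · exact ((hθ.pow 2).add (hQc.pow 2)).continuousOn
    · intro x hx
      have h1 := (hθd x ⟨by linarith [hx.1], by linarith [hx.2]⟩).pow 2
      have h2 := (hQd x hx).pow 2
      have h3 := h1.add h2
      have h4 : f = θ ^ 2 + Q ^ 2 := rfl
      rw [h4]
      refine h3.congr_deriv ?_
      push_cast; ring
    · intro x hx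
      have hb1 := hC x ⟨by linarith [hx.1], by linarith [hx.2]⟩
      rw [Real.norm_eq_abs] at hb1
      have e1 : 2 * θ x * (Q x / μ) + 2 * Q x * (- g x)
        = (2 * θ x * Q x) * (1/μ - (K x - θ x)) := by
          simp only [hg]; ring
      rw [e1, abs_mul, mul_comm]
      apply mul_le_mul _ _ (abs_nonneg _) (by positivity)
      · calc |1/μ - (K x - θ x)| ≤ |1/μ| + |K x - θ x| := abs_sub _ _
          _ ≤ 1/μ + C := by rw [abs_of_pos (by positivity)]; simpa using hb1
      · rw [abs_le]; constructor <;> nlinarith [sq_nonneg (θ x + Q x), sq_nonneg (θ x - Q x)]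
  have hmin : ∀ x ∈ Icc (-(1/2):ℝ) (1/2), θ x = 0 → Q x = 0 := by
    have hr : ∀ x ∈ Ico (-(1/2):ℝ) (1/2), θ x = 0 → 0 ≤ Q x := by
      intro x hx hx0
      by_contra hneg
      push Not at hneg
      have hev : ∀ᶠ y in 𝓝 x, Q y < 0 := hQc.continuousAt.eventually (gt_mem_nhds hneg)
      obtain ⟨δ, hδ, hball⟩ := Metric.eventually_nhds_iff.1 hev
      set y := min (x + δ/2) (1/2) with hy
      have hxy : x < y := lt_min (by linarith) hx.2
      have hyδ : y ≤ x + δ/2 := min_le_left _ _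
      have hy2 : y ≤ 1/2 := min_le_right _ _
      have := intervalIntegral.intervalIntegral_pos_of_pos_on (f := fun z => - Q z)
        (hQc.neg.intervalIntegrable _ _) (by
          intro z hz
          have := @hball z (by
            rw [Real.dist_eq, abs_of_pos (by linarith [hz.1])]; linarith [hz.2])
          linarith) hxy
      rw [intervalIntegral.integral_neg, hQi x ⟨hx.1, hx.2.le⟩ y ⟨by linarith [hx.1], hy2⟩, hx0] at this
      nlinarith [hθ0 y]
    have hl : ∀ x ∈ Ioc (-(1/2):ℝ) (1/2), θ x = 0 → Q x ≤ 0 := by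
      intro x hx hx0
      by_contra hneg
      push Not at hneg
      have hev : ∀ᶠ y in 𝓝 x, 0 < Q y := hQc.continuousAt.eventually (lt_mem_nhds hneg)
      obtain ⟨δ, hδ, hball⟩ := Metric.eventually_nhds_iff.1 hev
      set y := max (x - δ/2) (-(1/2)) with hy
      have hxy : y < x := max_lt (by linarith) hx.1
      have hyδ : x - δ/2 ≤ y := le_max_left _ _
      have hy2 : -(1/2) ≤ y := le_max_right _ _
      have := intervalIntegral.intervalIntegral_pos_of_pos_on (f := fun z => Q z)
        (hQc.intervalIntegrable _ _) (by
          intro z hz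
          exact @hball z (by
            rw [Real.dist_eq, abs_of_neg (by linarith [hz.2])]; linarith [hz.1])) hxy
      rw [hQi y ⟨hy2, by linarith [hx.2]⟩ x ⟨hx.1.le, hx.2⟩, hx0] at this
      nlinarith [hθ0 y]
    intro x hx hx0
    rcases hx.1.eq_or_lt with h | h
    · rw [← h] at hx0 ⊢
      apply le_antisymm
      · rw [hQp]; exact hl _ (by norm_num) (by rw [← hθp]; exact hx0)
      · exact hr _ (by norm_num) hx0
    rcases hx.2.eq_or_lt with h' | h'
    · rw [h'] at hx0 ⊢
      apply le_antisymm
      · exact hl _ (by norm_num) hx0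
      · rw [← hQp]; exact hr _ (by norm_num) (by rw [hθp]; exact hx0)
    · exact le_antisymm (hl x ⟨h, hx.2⟩ hx0) (hr x ⟨hx.1, h'⟩ hx0)
  have hpos : ∀ x ∈ Icc (-(1/2):ℝ) (1/2), 0 < θ x := by
    intro x hx
    by_contra hn
    have hx0 : θ x = 0 := le_antisymm (not_lt.1 hn) (hθ0 x)
    have hQx := hmin x hx hx0
    by_cases h1 : x < s
    · have := (hode x s h1.le hx.1 hsI.2 (by
        apply le_antisymm (hFm h1.le)
        rw [hFs, ← hF0]; exact hFm hx.1)).1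
      simp only [hx0, hQx, hSM s hsS, hQS s hsS] at this
      norm_num at this
      exact absurd this (by positivity)
    by_cases h2 : t < x
    · have := (hode t x h2.le htI.1 hx.2 (by
        apply le_antisymm (hFm h2.le)
        rw [hFt, ← hF1]; exact hFm hx.2)).2
      simp only [hx0, hQx, hSM t htS, hQS t htS] at this
      norm_num at this
      exact absurd this (by positivity)
    · have : x ∈ S := by rw [hSst]; exact ⟨not_lt.1 h1, not_lt.1 h2⟩
      rw [hSM x this] at hx0; linarith
  -- evenness
  have hnegI : ∀ x ∈ Icc (-(1/2):ℝ) (1/2), -x ∈ Icc (-(1/2):ℝ) (1/2) := fun x hx =>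
    ⟨by linarith [hx.2], by linarith [hx.1]⟩
  have hle : ∀ x ∈ Icc (-(1/2):ℝ) (1/2), θ x ≤ θ (-x) := by
    by_contra hcon
    push Not at hcon
    obtain ⟨x0, hx0, hlt0⟩ := hcon
    obtain ⟨x, hx, hmax⟩ := (isCompact_Icc (a := (-(1/2):ℝ)) (b := 1/2)).exists_isMaxOn
      ⟨x0, hx0⟩ (f := fun x => θ x / θ (-x))
      (hθ.continuousOn.div (by fun_prop) (fun x hx => (hpos _ (hnegI x hx)).ne'))
    set τ := θ x / θ (-x) with hτ
    have hτ1 : 1 < τ := lt_of_lt_of_le ((one_lt_div (hpos _ (hnegI _ hx0))).2 hlt0) (hmax hx0)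
    have hpx := hpos _ (hnegI x hx)
    have hθτ : θ x = τ * θ (-x) := by rw [hτ]; field_simp
    have hθτ' : ∀ y ∈ Icc (-(1/2):ℝ) (1/2), θ y ≤ τ * θ (-y) := by
      intro y hy
      have : θ y / θ (-y) ≤ τ := hmax hy
      rwa [div_le_iff₀ (hpos _ (hnegI y hy))] at this
    have hxlt : θ (-x) < θ x := by rw [hθτ]; nlinarith
    have hxI : x ∈ Ioo (-(1/2):ℝ) (1/2) := by
      refine ⟨lt_of_le_of_ne hx.1 ?_, lt_of_le_of_ne hx.2 ?_⟩
      · intro h; rw [← h, neg_neg, hθp] at hxlt; exact lt_irrefl _ hxlt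
      · intro h; rw [h, hθp] at hxlt; exact lt_irrefl _ hxlt
    have hxS : -x ∉ S := fun h => by
      have := hSM _ h
      linarith [hθM x]
    obtain ⟨δ, hδ, hball⟩ := Metric.isOpen_iff.1 hScl.isOpen_compl (-x) hxS
    have hFloc : ∀ y, x ≤ y → y < x + δ → F (-y) = F (-x) := by
      intro y h1 h2
      apply hgap _ _ (by linarith)
      ext z; simp only [mem_inter_iff, mem_Ioo, mem_empty_iff_false, iff_false]
      rintro ⟨⟨hz1, hz2⟩, hzS⟩
      exact hball (show z ∈ Metric.ball (-x) δ by
        rw [Metric.mem_ball, Real.dist_eq, abs_of_neg (by linarith)]; linarith) hzS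
    -- v = θ - τ θ(-·), μ v' = Q + τ Q(-·)
    have hv0 : Q x + τ * Q (-x) = 0 := by
      have d1 := hθd x hxI
      have d2 := hθd (-x) ⟨by linarith [hxI.2], by linarith [hxI.1]⟩
      have d3 : HasDerivAt (fun y => θ (-y)) (-(Q (-x)/μ)) x := by
        have h5 := d2.comp x (hasDerivAt_neg x)
        exact h5.congr_deriv (by ring)
      have d4 := d1.sub (d3.const_mul τ)
      have hloc : IsLocalMax (θ - fun y => τ * θ (-y)) x := by
        filter_upwards [Ioo_mem_nhds hxI.1 hxI.2] with y hy
        have := hθτ' y ⟨hy.1.le, hy.2.le⟩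
        simp only [Pi.sub_apply]; linarith
      have := hloc.hasDerivAt_eq_zero d4
      field_simp at this
      linarith
    obtain ⟨y, hy, hyp⟩ := ddR (fun y => Q y + τ * Q (-y)) (fun y => τ * g (-y) - g y)
      (by fun_prop) (by fun_prop) x (min (x+δ) (1/2)) (lt_min (by linarith) hxI.2)
      (by
        simp only [hg]; rw [hKe, ← mul_assoc, ← hθτ]
        have : 0 < θ x := by linarith
        nlinarith) hv0.ge (by
        intro y hy
        have hy1 : y < x + δ := lt_of_lt_of_le hy.2 (min_le_left _ _)
        rw [intervalIntegral.integral_sub (by apply Continuous.intervalIntegrable; fun_prop)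
          (hgc.intervalIntegrable _ _), intervalIntegral.integral_const_mul,
          intervalIntegral.integral_comp_neg, hAi, hAi]
        simp only [hQ]
        rw [hFloc y hy.1.le hy1]
        have := mul_le_mul_of_nonneg_left (hFm hy.1.le) he.le
        linarith)
    have hy2 : y < 1/2 := lt_of_lt_of_le hy.2 (min_le_right _ _)
    have hyI : y ∈ Icc (-(1/2):ℝ) (1/2) := ⟨by linarith [hx.1, hy.1], hy2.le⟩
    rw [intervalIntegral.integral_add (hQc.intervalIntegrable _ _)
      (by apply Continuous.intervalIntegrable; fun_prop), intervalIntegral.integral_const_mul,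
      intervalIntegral.integral_comp_neg, hQi x hx y hyI, hQi _ (hnegI y hyI) _ (hnegI x hx)] at hyp
    have := hθτ' y hyI
    nlinarith
  have heven : ∀ x ∈ Icc (-(1/2):ℝ) (1/2), θ (-x) = θ x := fun x hx =>
    le_antisymm (by have := hle _ (hnegI x hx); rwa [neg_neg] at this) (hle x hx)
  have hQodd' : ∀ x ∈ Ioo (-(1/2):ℝ) (1/2), Q x + Q (-x) = 0 := by
    intro x hxI
    have d1 := hθd x hxI
    have d2 := hθd (-x) ⟨by linarith [hxI.2], by linarith [hxI.1]⟩
    have d3 : HasDerivAt (fun y => θ (-y)) (-(Q (-x)/μ)) x := by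
      have h5 := d2.comp x (hasDerivAt_neg x)
      exact h5.congr_deriv (by ring)
    have d4 : HasDerivAt θ (-(Q (-x)/μ)) x := by
      refine d3.congr_of_eventuallyEq ?_
      filter_upwards [Ioo_mem_nhds hxI.1 hxI.2] with y hy
      exact (heven y ⟨hy.1.le, hy.2.le⟩).symm
    have := d1.unique d4
    field_simp at this
    linarith
  have hQodd : ∀ x ∈ Icc (-(1/2):ℝ) (1/2), Q x + Q (-x) = 0 := by
    have hcl : closure (Ioo (-(1/2):ℝ) (1/2)) = Icc (-(1/2)) (1/2) := closure_Ioo (by norm_num)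
    rw [← hcl]
    exact closure_minimal hQodd' (isClosed_eq (by fun_prop) continuous_const)
  have hgeven : ∀ x ∈ Icc (-(1/2):ℝ) (1/2), g (-x) = g x := by
    intro x hx; simp only [hg]; rw [heven x hx, hKe]
  have hAsym : ∀ x ∈ Icc (-(1/2):ℝ) (1/2), A (-x) = e - A x := by
    intro x hx
    have h1 : ∫ z in (-(1/2):ℝ)..(-x), g (-z) = ∫ z in (-(1/2):ℝ)..(-x), g z := by
      apply intervalIntegral.integral_congr
      intro z hz
      rw [uIcc_of_le (by linarith [hx.2])] at hz
      exact hgeven z ⟨hz.1, by linarith [hz.2, hx.1]⟩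
    rw [intervalIntegral.integral_comp_neg, neg_neg, neg_neg, hAi, hAi, hA0, hA1] at h1
    linarith
  have hFsym : ∀ x ∈ Icc (-(1/2):ℝ) (1/2), F (-x) = 1 - F x := by
    intro x hx
    have h1 := hQodd x hx
    have h2 := hQodd (1/2) (by norm_num)
    simp only [hQ] at h1 h2
    rw [hAsym x hx] at h1
    rw [hA0, hA1, hF0, hF1] at h2
    have : e * (F (-x) - (1 - F x)) = 0 := by linarith
    rcases mul_eq_zero.1 this with h | h
    · linarith
    · linarith
  have ht1 : t ≤ -s := by
    by_contra h
    push Not at h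
    have h1 := hFsym s hsI
    have h2 := hsup (-s) (t+1) t htS h (by linarith)
    have h3 := hsup (-s) (1/2)
    have h4 : F (t + 1) = 1 := by
      rw [← hFt]; symm
      apply hgap _ _ (by linarith)
      ext x; simp only [mem_inter_iff, mem_Ioo, mem_empty_iff_false, iff_false]
      rintro ⟨⟨h, _⟩, h'⟩; linarith [htle x h']
    linarith
  have ht2 : -s ≤ t := by
    by_contra h
    push Not at h
    have h1 := hFsym t htI
    have h2 := hsup (s-1) (-t) s hsS (by linarith) (by linarith)
    have h4 : F (s - 1) = 0 := by
      rw [← hFs]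
      apply hgap _ _ (by linarith)
      ext x; simp only [mem_inter_iff, mem_Ioo, mem_empty_iff_false, iff_false]
      rintro ⟨⟨_, h⟩, h'⟩; linarith [hsle x h']
    linarith
  have hts : s = -t := by linarith
  refine ⟨t, ⟨by linarith, htI.2⟩, ?_⟩
  rw [hSst, hts]

lemma real_diff (m : Measure ℝ) [IsProbabilityMeasure m] (p q : ℝ) (h : p ≤ q) :
    m.real (Iic q) = m.real (Iic p) + m.real (Ioc p q) := by
  rw [← Iic_union_Ioc_eq_Iic h, measureReal_union]
  · exact Set.disjoint_left.2 fun x hx hx' => not_lt.2 hx hx'.1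
  · exact measurableSet_Ioc

lemma maxpt (μ e M c : ℝ) (hμ : 0 < μ) (he : 0 < e) (θ g : ℝ → ℝ) (hg : Continuous g)
    (hθM : ∀ x, θ x ≤ M) (hθp : θ (-(1/2)) = θ (1/2))
    (m : Measure ℝ) [IsProbabilityMeasure m] (hm : m tI = 1)
    (hint : ∫ x in (-(1/2):ℝ)..(1/2), g x = e)
    (heq : ∀ x ∈ Icc (-(1/2):ℝ) (1/2), μ * (θ x - θ (-(1/2))) =
      ∫ z in (-(1/2):ℝ)..x, (e * m.real (Iic z) - (∫ w in (-(1/2):ℝ)..z, g w) + c))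
    (hF0 : m.real (Iic (-(1/2))) = 0) (hF1 : m.real (Iic (1/2)) = 1)
    (x : ℝ) (hx : x ∈ Icc (-(1/2):ℝ) (1/2)) (hxM : θ x = M) :
    e * m.real (Iic x) - (∫ w in (-(1/2):ℝ)..x, g w) + c = 0 ∧ m.real {x} = 0 := by
  set A : ℝ → ℝ := fun x => ∫ w in (-(1/2):ℝ)..x, g w with hA
  have hAc : Continuous A := continuous_iff_continuousAt.2 fun x =>
    (hg.integral_hasStrictDerivAt (-(1/2)) x).hasDerivAt.continuousAt
  set F : ℝ → ℝ := fun z => m.real (Iic z) with hF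
  have hFm : Monotone F := fun a b h => measureReal_mono (Iic_subset_Iic.2 h)
  set Q : ℝ → ℝ := fun x => e * F x - A x + c with hQ
  have hA0 : A (-(1/2)) = 0 := by simp [hA]
  have hA1 : A (1/2) = e := hint
  have hQp : Q (-(1/2)) = Q (1/2) := by
    have h0 : F (-(1/2)) = 0 := hF0
    have h1 : F (1/2) = 1 := hF1
    simp only [hQ]; rw [hA0, hA1, h0, h1]; ring
  have hQI : ∀ a b, IntervalIntegrable Q volume a b := fun a b =>
    ((hFm.intervalIntegrable.const_mul e).sub (hAc.intervalIntegrable a b)).add (by simp)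
  have hQi : ∀ x ∈ Icc (-(1/2):ℝ) (1/2), ∀ y ∈ Icc (-(1/2):ℝ) (1/2),
      ∫ z in x..y, Q z = μ * (θ y - θ x) := by
    intro x hx y hy
    rw [← intervalIntegral.integral_interval_sub_left (a := -(1/2)) (hQI _ _) (hQI _ _)]
    have h1 := heq x hx
    have h2 := heq y hy
    change _ = ∫ z in (-(1/2):ℝ)..x, Q z at h1
    change _ = ∫ z in (-(1/2):ℝ)..y, Q z at h2
    linarith
  have hr : ∀ x ∈ Ico (-(1/2):ℝ) (1/2), θ x = M → Q x ≤ 0 := by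
    intro x hx hx0
    by_contra hneg
    push Not at hneg
    have hev : ∀ᶠ y in 𝓝 x, 0 < Q x - (A y - A x) := by
      have hcont : Continuous fun y => Q x - (A y - A x) := by fun_prop
      exact hcont.continuousAt.eventually (lt_mem_nhds (by simpa using hneg))
    obtain ⟨δ, hδ, hball⟩ := Metric.eventually_nhds_iff.1 hev
    set y := min (x + δ/2) (1/2) with hy
    have hxy : x < y := lt_min (by linarith) hx.2
    have hyδ : y ≤ x + δ/2 := min_le_left _ _
    have hy2 : y ≤ 1/2 := min_le_right _ _
    have := intervalIntegral.intervalIntegral_pos_of_pos_on (f := Q) (hQI _ _) (by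
        intro z hz
        have h1 := @hball z (by
          rw [Real.dist_eq, abs_of_pos (by linarith [hz.1])]; linarith [hz.2])
        have h2 := mul_le_mul_of_nonneg_left (hFm hz.1.le) he.le
        simp only [hQ] at h1 ⊢
        linarith) hxy
    rw [hQi x ⟨hx.1, hx.2.le⟩ y ⟨by linarith [hx.1], hy2⟩, hx0] at this
    nlinarith [hθM y]
  have hl : ∀ x ∈ Ioc (-(1/2):ℝ) (1/2), θ x = M → 0 ≤ Q x - e * m.real {x} := by
    intro x hx hx0
    by_contra hneg
    push Not at hneg
    have hev : ∀ᶠ y in 𝓝 x, Q x - e * m.real {x} + (A x - A y) < 0 := by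
      have hcont : Continuous fun y => Q x - e * m.real {x} + (A x - A y) := by fun_prop
      exact hcont.continuousAt.eventually (gt_mem_nhds (by simpa using hneg))
    obtain ⟨δ, hδ, hball⟩ := Metric.eventually_nhds_iff.1 hev
    set y := max (x - δ/2) (-(1/2)) with hy
    have hxy : y < x := max_lt (by linarith) hx.1
    have hyδ : x - δ/2 ≤ y := le_max_left _ _
    have hy2 : -(1/2) ≤ y := le_max_right _ _
    have := intervalIntegral.intervalIntegral_pos_of_pos_on (f := fun z => - Q z) (hQI _ _).neg (by
        intro z hz
        have h1 := @hball z (by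
          rw [Real.dist_eq, abs_of_neg (by linarith [hz.2])]; linarith [hz.1])
        have h2 : F z + m.real {x} ≤ F x := by
          have h3 := real_diff m z x hz.2.le
          have h4 : m.real {x} ≤ m.real (Ioc z x) :=
            measureReal_mono (singleton_subset_iff.2 ⟨hz.2, le_refl x⟩)
          simp only [hF]; linarith
        have h2 := mul_le_mul_of_nonneg_left h2 he.le
        simp only [hQ] at h1 ⊢
        linarith) hxy
    rw [intervalIntegral.integral_neg, hQi y ⟨hy2, by linarith [hx.2]⟩ x ⟨hx.1.le, hx.2⟩, hx0] at this
    nlinarith [hθM y]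
  have hnn : ∀ x, 0 ≤ m.real {x} := fun x => measureReal_nonneg
  change Q x = 0 ∧ _
  rcases hx.1.eq_or_lt with h | h
  · rw [← h] at hxM ⊢
    have h1 := hr (-(1/2)) (by norm_num) hxM
    have h2 := hl (1/2) (by norm_num) (by rw [← hθp]; exact hxM)
    have h3 := mul_nonneg he.le (hnn (1/2))
    refine ⟨by linarith, le_antisymm ?_ (hnn _)⟩
    rw [← hF0]; exact measureReal_mono (by simp)
  · have h2 := hl x ⟨h, hx.2⟩ hxM
    have h3 := mul_nonneg he.le (hnn x)
    have h1 : Q x ≤ 0 := by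
      rcases hx.2.eq_or_lt with h' | h'
      · rw [h', ← hQp]
        exact hr _ (by norm_num) (by rw [hθp, ← h']; exact hxM)
      · exact hr x ⟨hx.1, h'⟩ hxM
    have h4 : e * m.real {x} = 0 := by linarith
    refine ⟨by linarith, ?_⟩
    rcases mul_eq_zero.1 h4 with h | h
    · linarith
    · exact h

/-- Lemma 6.4: the support of the equilibrium distribution of
fishermen is a symmetric interval. If `(λ̄, θ̄, m̄, ū)` solves (MFG_ergo,1D) with
`θ̄ ≢ 0`, and (from the weak KAM characterization)
`supp(m̄) ⊆ {θ̄ = ‖θ̄‖_{L^∞(𝕋)}}`, then `supp(m̄) = [-y, y]` for some `y ∈ (0, 0.5]`. -/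
theorem support_symmetric_interval (μ ε : ℝ) (hμ : 0 < μ) (hε : 0 < ε)
    (K : ℝ → ℝ) (hK : K1D K)
    (lam : ℝ) (θ u : ℝ → ℝ) (m : Measure ℝ)
    (hsol : IsErgo1DSol μ ε lam K θ u m) (hθne : θ ≠ 0)
    (hKAM : msupp m ⊆ {x | θ x = sSup (θ '' Icc (-(1/2):ℝ) (1/2))}) :
    ∃ y ∈ Ioc (0:ℝ) (1/2), msupp m = Icc (-y) y := by
  obtain ⟨hKC, hKp, hKe, hKd⟩ := hK
  obtain ⟨hθp, hθ, hθ0, -, -, -, -, hprob, hm, -, -, -, hw⟩ := hsol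
  have hKc : Continuous K := hKC.continuous
  have hKs : StrictAntiOn K (Icc 0 (1/2)) := by
    apply strictAntiOn_of_deriv_neg (convex_Icc _ _) hKc.continuousOn
    rw [interior_Icc]; exact hKd
  set M := sSup (θ '' Icc (-(1/2):ℝ) (1/2)) with hMdef
  have hbdd : BddAbove (θ '' Icc (-(1/2):ℝ) (1/2)) :=
    (isCompact_Icc.image hθ).bddAbove
  have hθM : ∀ x, θ x ≤ M := by
    intro x
    have hper : Function.Periodic θ 1 := hθp
    obtain ⟨y, hy, hxy⟩ := hper.exists_mem_Ico one_pos x (-(1/2))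
    rw [hxy]
    apply le_csSup hbdd
    refine ⟨y, ⟨hy.1, ?_⟩, rfl⟩
    have := hy.2; linarith
  have hM : 0 < M := by
    by_contra hn
    apply hθne
    ext x
    exact le_antisymm ((hθM x).trans (not_lt.1 hn)) (hθ0 x)
  have hθpp : θ (-(1/2)) = θ (1/2) := by
    have := hθp (-(1/2))
    rw [← this]; norm_num
  -- support facts
  have hcompl : m tIᶜ = 0 := by
    rw [prob_compl_eq_zero_iff (by unfold tI; exact measurableSet_Ioc)]; exact hm
  have hScl : IsClosed (msupp m) := by
    rw [← isOpen_compl_iff, isOpen_iff_forall_mem_open]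
    intro x hx
    simp only [msupp, mem_compl_iff, mem_setOf_eq, not_forall] at hx
    obtain ⟨U, hU, hxU, h0⟩ := hx
    exact ⟨U, fun y hy hyS => h0 (hyS U hU hy), hU, hxU⟩
  have hnull : m (msupp m)ᶜ = 0 := by
    apply measure_null_of_locally_null
    intro x hx
    simp only [msupp, mem_compl_iff, mem_setOf_eq, not_forall] at hx
    obtain ⟨U, hU, hxU, h0⟩ := hx
    exact ⟨U, mem_nhdsWithin_of_mem_nhds (hU.mem_nhds hxU), by simpa using h0⟩
  have hSsub : msupp m ⊆ Icc (-(1/2)) (1/2) := by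
    intro x hx
    by_contra hn
    have := hx (Icc (-(1/2)) (1/2))ᶜ isClosed_Icc.isOpen_compl hn
    refine this.ne' (measure_mono_null (compl_subset_compl.2 ?_) hcompl)
    exact Ioc_subset_Icc_self
  have hSM : ∀ x ∈ msupp m, θ x = M := fun x hx => hKAM hx
  have hF0 : m.real (Iic (-(1/2))) = 0 := by
    rw [measureReal_eq_zero_iff]
    refine measure_mono_null ?_ hcompl
    intro x hx hx'
    exact absurd hx'.1 (not_lt.2 hx)
  have hF1 : m.real (Iic (1/2)) = 1 := by
    have h1 := real_diff m (-(1/2)) (1/2) (by norm_num)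
    have h2 : m.real (Ioc (-(1/2)) (1/2)) = 1 := by
      have : m (Ioc (-(1/2)) (1/2)) = 1 := hm
      simp only [Measure.real]; rw [this]; simp
    rw [h1, h2, hF0, zero_add]
  set g : ℝ → ℝ := fun x => θ x * (K x - θ x) with hg
  have hgc : Continuous g := hθ.mul (hKc.sub hθ)
  have hwk : ∀ φ : ℝ → ℝ, ContDiff ℝ 2 φ → Per1 φ →
      -(μ * ∫ x in tI, θ x * deriv (deriv φ) x)
        = (∫ x in tI, g x * φ x) - (ε * M) * ∫ x, φ x ∂m := by
    intro φ hφ hφp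
    rw [hw φ hφ hφp]
    have : ∫ x, θ x * φ x ∂m = ∫ x, M * φ x ∂m := by
      apply integral_congr_ae
      have hae : ∀ᵐ x ∂m, x ∈ msupp m := hnull
      filter_upwards [hae] with x hx
      rw [hSM x hx]
    rw [this, integral_const_mul]; ring
  have he : 0 < ε * M := mul_pos hε hM
  obtain ⟨hint, c, heq⟩ := reg μ (ε * M) θ g hθ hgc hθp m hm hwk
  have hmax := maxpt μ (ε * M) M c hμ he θ g hgc hθM hθpp m hm hint heq hF0 hF1
  have hatom : ∀ x, m {x} = 0 := by
    intro x
    by_contra hne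
    have hxS : x ∈ msupp m := fun U hU hxU =>
      lt_of_lt_of_le (pos_iff_ne_zero.2 hne) (measure_mono (singleton_subset_iff.2 hxU))
    have := (hmax x (hSsub hxS) (hSM x hxS)).2
    rw [measureReal_eq_zero_iff] at this
    exact hne this
  have hFm : Monotone (fun x => m.real (Iic x)) :=
    fun a b h => measureReal_mono (Iic_subset_Iic.2 h)
  have hFc : Continuous (fun x => m.real (Iic x)) := by
    have hFcdf : (fun x => m.real (Iic x)) = ProbabilityTheory.cdf m := by
      ext z; rw [ProbabilityTheory.cdf_eq_real]
    rw [hFcdf, continuous_iff_continuousAt]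
    intro x
    rw [(ProbabilityTheory.monotone_cdf m).continuousAt_iff_leftLim_eq_rightLim,
      StieltjesFunction.rightLim_eq]
    have h1 := (ProbabilityTheory.cdf m).measure_singleton x
    rw [ProbabilityTheory.measure_cdf, hatom x] at h1
    have h2 := ENNReal.ofReal_eq_zero.1 h1.symm
    exact le_antisymm ((ProbabilityTheory.monotone_cdf m).leftLim_le le_rfl) (by linarith)
  refine core (μ := μ) (e := ε * M) (M := M) (c := c) (K := K) (θ := θ)
    (F := fun x => m.real (Iic x)) (S := msupp m)
    ⟨hμ, he, hM, hKc, hKe, hKs, hθ, hθ0, hθM, hθpp, hFc, hFm, hF0, hF1, hScl, hSsub, ?_, ?_,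
    hint, heq, hSM, fun x hx => (hmax x (hSsub hx) (hSM x hx)).1⟩
  · intro p q hpq hne
    have h1 := real_diff m p q hpq
    have h2 : m.real (Ioc p q) = 0 := by
      rw [measureReal_eq_zero_iff]
      refine measure_mono_null (t := (msupp m)ᶜ ∪ {q}) ?_ (measure_union_null hnull (hatom q))
      intro x hx
      rcases hx.2.eq_or_lt with h | h
      · right; exact h
      · left; intro hxS
        have : x ∈ Ioo p q ∩ msupp m := ⟨⟨hx.1, h⟩, hxS⟩
        rw [hne] at this; exact this
    linarith
  · intro p q x hx hpx hxq
    have h1 := real_diff m p q (hpx.trans hxq).le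
    have h2 : 0 < m.real (Ioc p q) := by
      have := hx (Ioo p q) isOpen_Ioo ⟨hpx, hxq⟩
      refine lt_of_lt_of_le ?_ (measureReal_mono Ioo_subset_Ioc_self)
      exact ENNReal.toReal_pos this.ne' (measure_ne_top _ _)
    linarith

end
end
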